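/- arXiv:math/0010237 — 2 statements merged into one kernel-verified Lean document; each statement's English description precedes it below -/
import Mathlib

section
/- Every even Lagrangian matroid is orientable and admits exactly one orientation: for any fundamental basis F, the unique orientation relative to F is given by s_F(A) = (−1)^{h(A)/2}, where h is the height relative to F (which is even for every basis A of an even Lagrangian matroid). -/
open Finset Matrix
open scoped Classical

/-- The index set `J = I ∪ I*`: the element `(i, false)` represents the unstarred
index `i+1`, and `(i, true)` represents the starred index `(i+1)*`. -/
abbrev JJ (n : ℕ) := Fin n × Bool

/-- The involution `* : J → J`. -/
def starJ {n : ℕ} (x : JJ n) : JJ n := (x.1, !x.2)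

/-- A subset `A ⊆ J` is admissible iff `A ∩ A* = ∅`. -/
def AdmissibleSet {n : ℕ} (A : Finset (JJ n)) : Prop := ∀ x ∈ A, starJ x ∉ A

/-- An admissible permutation of `J`: one commuting with `*`.  These form the
hyperoctahedral group `W = BC_n`. -/
def AdmissiblePerm {n : ℕ} (w : Equiv.Perm (JJ n)) : Prop := ∀ x, w (starJ x) = starJ (w x)

/-- The standard ordering `n* < … < 1* < 1 < … < n` on `J`, encoded by a value in `ℤ`. -/
def ordJ {n : ℕ} (x : JJ n) : ℤ := if x.2 then -((x.1 : ℤ) + 1) else (x.1 : ℤ) + 1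

/-- The ordering `≤^w` on `J`: `x ≤^w y` iff `w⁻¹ x ≤ w⁻¹ y` in the standard order. -/
def leW {n : ℕ} (w : Equiv.Perm (JJ n)) (x y : JJ n) : Prop :=
  ordJ (w.symm x) ≤ ordJ (w.symm y)

/-- The (Gale) ordering induced by `≤^w` on admissible subsets: `A ≼^w B` iff the
sorted lists dominate componentwise, equivalently iff there is a bijection
`f : A → B` with `a ≤^w f a` for all `a ∈ A`. -/
def setLE {n : ℕ} (w : Equiv.Perm (JJ n)) (A B : Finset (JJ n)) : Prop :=
  ∃ f : JJ n → JJ n, Set.BijOn f ↑A ↑B ∧ ∀ a ∈ A, leW w a (f a)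

/-- `ℬ` is the collection of bases of a symplectic matroid of rank `k`: all members
are admissible `k`-sets, and for every admissible permutation `w` there is a
(necessarily unique) `≤^w`-maximal member (the Maximality Property). -/
def IsSymplecticMatroid {n : ℕ} (k : ℕ) (ℬ : Finset (Finset (JJ n))) : Prop :=
  (∀ A ∈ ℬ, AdmissibleSet A ∧ A.card = k) ∧
  ∀ w : Equiv.Perm (JJ n), AdmissiblePerm w → ∃ A ∈ ℬ, ∀ B ∈ ℬ, setLE w B A

/-- A Lagrangian matroid is a symplectic matroid of rank `n`. -/
def IsLagrangianMatroid {n : ℕ} (ℬ : Finset (Finset (JJ n))) : Prop :=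
  IsSymplecticMatroid n ℬ
/-- The vector `e_j ∈ ℝ^n` for `j ∈ J`: `e_i` for unstarred `i`, `-e_i` for starred. -/
def eVec {n : ℕ} (x : JJ n) : Fin n → ℝ :=
  fun i => if i = x.1 then (if x.2 then -1 else 1) else 0

/-- The point `e_A = Σ_{j ∈ A} e_j ∈ ℝ^n` associated to an admissible set `A`. -/
def eSet {n : ℕ} (A : Finset (JJ n)) : Fin n → ℝ := ∑ x ∈ A, eVec x

/-- The matroid polytope: the convex hull of the points `e_A`, `A ∈ ℬ`. -/
def matroidPolytope {n : ℕ} (ℬ : Finset (Finset (JJ n))) : Set (Fin n → ℝ) :=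
  convexHull ℝ (eSet '' ↑ℬ)

/-- Bases `A` and `B` are joined by an edge of the matroid polytope: there is a linear
functional taking equal maximal values at `e_A`, `e_B` and strictly smaller values at
all other vertices. -/
def IsEdge {n : ℕ} (ℬ : Finset (Finset (JJ n))) (A B : Finset (JJ n)) : Prop :=
  A ∈ ℬ ∧ B ∈ ℬ ∧ A ≠ B ∧
  ∃ L : (Fin n → ℝ) →ₗ[ℝ] ℝ, L (eSet A) = L (eSet B) ∧
    ∀ C ∈ ℬ, C ≠ A → C ≠ B → L (eSet C) < L (eSet A)

/-- The height of `A` relative to the fundamental basis `F`: `h(A) = n - |A ∩ F|`. -/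
def heightF {n : ℕ} (F A : Finset (JJ n)) : ℕ := n - (A ∩ F).card

/-- A short edge: an edge whose ends are related by a short exchange `A = B ∆ {i,i*}`. -/
def IsShortEdge {n : ℕ} (ℬ : Finset (Finset (JJ n))) (A B : Finset (JJ n)) : Prop :=
  IsEdge ℬ A B ∧ ∃ i : JJ n, symmDiff A B = ({i, starJ i} : Finset (JJ n))

/-- A long edge: an edge whose ends are related by a long exchange
`A = B ∆ {i,i*,j,j*}`, `i ∉ {j,j*}`. -/
def IsLongEdge {n : ℕ} (ℬ : Finset (Finset (JJ n))) (A B : Finset (JJ n)) : Prop :=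
  IsEdge ℬ A B ∧ ∃ i j : JJ n, i ≠ j ∧ i ≠ starJ j ∧
    symmDiff A B = ({i, starJ i, j, starJ j} : Finset (JJ n))

/-- The four bases of a 2-dimensional face of the matroid polytope which is a square
with short edges (type sSquare): `A`, `A ∆ {i,i*}`, `A ∆ {j,j*}`, `A ∆ {i,i*,j,j*}`,
all of them bases. -/
def ShortSquare {n : ℕ} (ℬ : Finset (Finset (JJ n))) (v : Fin 4 → Finset (JJ n)) : Prop :=
  ∃ (A : Finset (JJ n)) (i j : JJ n), i.1 ≠ j.1 ∧
    v 0 = A ∧ v 1 = symmDiff A ({i, starJ i} : Finset (JJ n)) ∧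
    v 2 = symmDiff A ({j, starJ j} : Finset (JJ n)) ∧
    v 3 = symmDiff A ({i, starJ i, j, starJ j} : Finset (JJ n)) ∧
    ∀ k : Fin 4, v k ∈ ℬ

/-- `sF` is an orientation of the Lagrangian matroid with bases `ℬ` relative to the
fundamental basis `F`: it takes values `±1` on bases and satisfies axioms (i)–(iv). -/
def IsOrientationRel {n : ℕ} (ℬ : Finset (Finset (JJ n))) (F : Finset (JJ n))
    (sF : Finset (JJ n) → ℤ) : Prop :=
  (∀ A ∈ ℬ, sF A = 1 ∨ sF A = -1) ∧
  (∀ A B : Finset (JJ n), IsLongEdge ℬ A B → heightF F A = heightF F B → sF A = sF B) ∧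
  (∀ A B : Finset (JJ n), IsLongEdge ℬ A B → heightF F A ≠ heightF F B → sF A = -sF B) ∧
  (∀ v : Fin 4 → Finset (JJ n), ShortSquare ℬ v →
    ∀ k : Fin 4,
      ((∀ l m : Fin 4, l ≠ k → m ≠ k → sF (v l) = sF (v m)) ∧
        ∃ l : Fin 4, l ≠ k ∧ sF (v l) ≠ sF (v k)) →
      (∀ l : Fin 4, heightF F (v l) ≤ heightF F (v k)) ∨
      (∀ l : Fin 4, heightF F (v k) ≤ heightF F (v l))) ∧
  sF F = 1

/-- `(ℬ, s)` is an oriented Lagrangian matroid: `s` vanishes when an argument is not a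
basis, each `s G` is an orientation relative to `G`, and the change-of-fundamental-basis
rule holds. -/
def IsOrientation {n : ℕ} (ℬ : Finset (Finset (JJ n)))
    (s : Finset (JJ n) → Finset (JJ n) → ℤ) : Prop :=
  (∀ G A : Finset (JJ n), G ∉ ℬ ∨ A ∉ ℬ → s G A = 0) ∧
  (∀ G ∈ ℬ, IsOrientationRel ℬ G (s G)) ∧
  (∀ G ∈ ℬ, ∀ H ∈ ℬ, ∀ A ∈ ℬ, s G A = s H A * s H G * (-1) ^ ((G \ (H ∪ A)).card))

/-- The choice of star at position `i`. -/
def chiS {n : ℕ} (S : Finset (JJ n)) (i : Fin n) : Bool := decide ((i, true) ∈ S)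

/-- The set of positions at which `A` and `B` differ. -/
def dS {n : ℕ} (A B : Finset (JJ n)) : Finset (Fin n) :=
  Finset.univ.filter fun i => chiS A i ≠ chiS B i

/-- A transversal: contains exactly one of `i, i*` for each `i`. -/
def IsTransversalJ {n : ℕ} (S : Finset (JJ n)) : Prop := ∀ i b, (i, b) ∈ S ↔ chiS S i = b

theorem mem_dS {n : ℕ} {A B : Finset (JJ n)} {i : Fin n} :
    i ∈ dS A B ↔ chiS A i ≠ chiS B i := by simp [dS]

theorem isTrans_of {n : ℕ} {S : Finset (JJ n)} (h : AdmissibleSet S) (hc : S.card = n) :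
    IsTransversalJ S := by
  have hinj : Set.InjOn (Prod.fst : JJ n → Fin n) ↑S := by
    rintro ⟨i, b⟩ hx ⟨j, c⟩ hy hxy
    simp only at hxy
    subst hxy
    have := h _ hx
    simp only [starJ] at this
    by_cases hbc : b = c
    · rw [hbc]
    · exfalso
      apply this
      have : c = !b := by cases b <;> cases c <;> simp_all
      rw [← this]; exact hy
  have himg : S.image Prod.fst = Finset.univ := by
    apply Finset.eq_univ_of_card
    rw [Finset.card_image_of_injOn hinj, hc, Fintype.card_fin]
  intro i b
  have hi : i ∈ S.image Prod.fst := by rw [himg]; simp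
  obtain ⟨⟨j, c⟩, hj, hji⟩ := Finset.mem_image.1 hi
  simp only at hji
  subst hji
  have h1 := h _ hj
  simp only [starJ] at h1
  unfold chiS
  cases b <;> cases c <;> simp_all

theorem trans_ext {n : ℕ} {A B : Finset (JJ n)} (hA : IsTransversalJ A) (hB : IsTransversalJ B)
    (h : dS A B = ∅) : A = B := by
  ext ⟨i, b⟩
  rw [hA, hB]
  have : i ∉ dS A B := by rw [h]; simp
  rw [mem_dS] at this
  push Not at this
  rw [this]

theorem dS_comm {n : ℕ} (A B : Finset (JJ n)) : dS A B = dS B A := by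
  ext i; simp only [mem_dS]; exact ne_comm

theorem dS_self {n : ℕ} (A : Finset (JJ n)) : dS A A = ∅ := by
  ext i; simp [mem_dS]

theorem height_eq {n : ℕ} {F A : Finset (JJ n)} (hF : IsTransversalJ F) (hA : IsTransversalJ A) :
    heightF F A = (dS F A).card := by
  have h1 : A ∩ F = (dS F A)ᶜ.image (fun i => (i, chiS A i)) := by
    ext ⟨i, b⟩
    simp only [Finset.mem_inter, hA i b, hF i b, Finset.mem_image, Finset.mem_compl, mem_dS,
      not_not, Prod.mk.injEq]
    constructor
    · rintro ⟨h, h'⟩; exact ⟨i, by rw [h, h'], rfl, h⟩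
    · rintro ⟨j, h, rfl, h'⟩; exact ⟨h', by rw [h, h']⟩
  unfold heightF
  rw [h1, Finset.card_image_of_injective _ (fun i j h => (Prod.mk.inj h).1), Finset.card_compl,
    Fintype.card_fin]
  have := (Finset.card_le_univ (dS F A))
  rw [Fintype.card_fin] at this
  omega

theorem true_card {n : ℕ} {A : Finset (JJ n)} (hA : IsTransversalJ A) :
    (A.filter fun x => x.2).card = (Finset.univ.filter fun i => chiS A i = true).card := by
  have : (A.filter fun x => x.2) =
      (Finset.univ.filter fun i => chiS A i = true).image (fun i => (i, true)) := by
    ext ⟨i, b⟩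
    simp only [Finset.mem_filter, hA i b, Finset.mem_image, Finset.mem_univ, true_and,
      Prod.mk.injEq]
    constructor
    · rintro ⟨h, h'⟩; exact ⟨i, by rw [h, h'], rfl, h'.symm⟩
    · rintro ⟨j, h, rfl, h'⟩; exact ⟨by rw [h, h'], h'.symm⟩
  rw [this, Finset.card_image_of_injective _ (fun i j h => (Prod.mk.inj h).1)]

theorem dS_parity {n : ℕ} (A B : Finset (JJ n)) :
    (dS A B).card + 2 * (Finset.univ.filter fun i => chiS A i = true ∧ chiS B i = true).card =
    (Finset.univ.filter fun i => chiS A i = true).card +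
    (Finset.univ.filter fun i => chiS B i = true).card := by
  simp only [dS, Finset.card_filter, Finset.mul_sum, ← Finset.sum_add_distrib]
  apply Finset.sum_congr rfl
  intro i _
  cases chiS A i <;> cases chiS B i <;> simp

theorem dS_triangle {n : ℕ} (G H A : Finset (JJ n)) :
    (dS G H).card + (dS G A).card = (dS H A).card +
      2 * (Finset.univ.filter fun i => chiS G i ≠ chiS H i ∧ chiS G i ≠ chiS A i).card := by
  simp only [dS, Finset.card_filter, Finset.mul_sum, ← Finset.sum_add_distrib]
  apply Finset.sum_congr rfl
  intro i _
  cases chiS A i <;> cases chiS G i <;> cases chiS H i <;> simp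

theorem sdiff_card {n : ℕ} {G H A : Finset (JJ n)} (hG : IsTransversalJ G) (hH : IsTransversalJ H)
    (hA : IsTransversalJ A) : (G \ (H ∪ A)).card =
      (Finset.univ.filter fun i => chiS G i ≠ chiS H i ∧ chiS G i ≠ chiS A i).card := by
  have : G \ (H ∪ A) =
      (Finset.univ.filter fun i => chiS G i ≠ chiS H i ∧ chiS G i ≠ chiS A i).image
        (fun i => (i, chiS G i)) := by
    ext ⟨i, b⟩
    simp only [Finset.mem_sdiff, Finset.mem_union, hA i b, hG i b, hH i b, Finset.mem_filter,
      Finset.mem_image, Finset.mem_univ, true_and, Prod.mk.injEq]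
    constructor
    · rintro ⟨rfl, h'⟩
      push Not at h'
      exact ⟨i, ⟨h'.1.symm, h'.2.symm⟩, rfl, rfl⟩
    · rintro ⟨j, h, rfl, rfl⟩
      exact ⟨rfl, by push Not; exact ⟨h.1.symm, h.2.symm⟩⟩
  rw [this, Finset.card_image_of_injective _ (fun i j h => (Prod.mk.inj h).1)]

theorem setLE_card {n : ℕ} {w : Equiv.Perm (JJ n)} {A B U : Finset (JJ n)} (h : setLE w A B)
    (hU : ∀ x ∈ U, ∀ y, leW w x y → y ∈ U) : (A ∩ U).card ≤ (B ∩ U).card := by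
  obtain ⟨f, hf, hle⟩ := h
  apply Finset.card_le_card_of_injOn f
  · intro x hx
    simp only [Finset.coe_inter, Set.mem_inter_iff, Finset.mem_coe] at hx ⊢
    exact ⟨hf.mapsTo hx.1, hU x hx.2 _ (hle x hx.1)⟩
  · intro x hx y hy hxy
    simp only [Finset.coe_inter, Set.mem_inter_iff, Finset.mem_coe] at hx hy
    exact hf.injOn hx.1 hy.1 hxy

/-- Existence of an admissible permutation realizing a prescribed weak order. -/
theorem exists_perm {n : ℕ} (key : Fin n → ℕ) (sg : Fin n → Bool) :
    ∃ w : Equiv.Perm (JJ n), AdmissiblePerm w ∧ ∀ x y, leW w x y →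
      (if x.2 = sg x.1 then (key x.1 : ℤ) + 1 else -((key x.1 : ℤ) + 1)) ≤
      (if y.2 = sg y.1 then (key y.1 : ℤ) + 1 else -((key y.1 : ℤ) + 1)) := by
  set τ := Tuple.sort key with hτ
  let v : Equiv.Perm (JJ n) :=
    { toFun := fun x => (τ.symm x.1, Bool.xor (!(sg x.1)) (!x.2))
      invFun := fun x => (τ x.1, Bool.xor (sg (τ x.1)) x.2)
      left_inv := by
        rintro ⟨i, b⟩; simp
      right_inv := by
        rintro ⟨i, b⟩; simp }
  have hv : ∀ x, v x = (τ.symm x.1, Bool.xor (!(sg x.1)) (!x.2)) := fun x => rfl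
  have hvs : ∀ x, v (starJ x) = starJ (v x) := by
    rintro ⟨i, b⟩
    simp only [hv, starJ]
    cases sg i <;> cases b <;> rfl
  refine ⟨v.symm, ?_, ?_⟩
  · intro x
    apply v.injective
    rw [hvs]; simp
  · have hm : ∀ k l, ((τ.symm k : Fin n) : ℤ) ≤ ((τ.symm l : Fin n) : ℤ) → key k ≤ key l := by
      intro k l h
      have h' : τ.symm k ≤ τ.symm l := by
        rw [Fin.le_def]; exact_mod_cast h
      have := Tuple.monotone_sort key h'
      simpa [← hτ] using this
    rintro ⟨i, b⟩ ⟨j, c⟩ h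
    simp only [leW, Equiv.symm_symm, hv, ordJ] at h
    have h1 := hm i j
    have h2 := hm j i
    simp only
    cases hi : sg i <;> cases hj : sg j <;> cases b <;> cases c <;>
      simp [hi, hj] at h ⊢ <;> omega

/-- The level function refined by the ordering used in the exchange argument. -/
def levelJ {n : ℕ} (a c : Fin n → Bool) (p : Fin n) (D : Finset (Fin n)) (x : JJ n) : ℤ :=
  if x.2 = (if x.1 = p then c x.1 else a x.1) then
    (((if x.1 = p then 1 else if x.1 ∈ D then 0 else 2 : ℕ)) : ℤ) + 1 else
    -((((if x.1 = p then 1 else if x.1 ∈ D then 0 else 2 : ℕ)) : ℤ) + 1)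

theorem levelJ_three {n : ℕ} (a c : Fin n → Bool) {p : Fin n} {D : Finset (Fin n)}
    (hp : p ∈ D) (x : JJ n) : 3 ≤ levelJ a c p D x ↔ x.1 ∉ D ∧ x.2 = a x.1 := by
  obtain ⟨i, b⟩ := x
  simp only [levelJ]
  by_cases h1 : i = p
  · subst h1; simp only [hp, if_true, not_true, false_and, iff_false]; split_ifs <;> simp
  · by_cases h2 : i ∈ D <;> by_cases h3 : b = a i <;> simp [h1, h2, h3]

theorem levelJ_two {n : ℕ} (a c : Fin n → Bool) {p : Fin n} {D : Finset (Fin n)}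
    (hp : p ∈ D) (x : JJ n) :
    2 ≤ levelJ a c p D x ↔ (x.1 ∉ D ∧ x.2 = a x.1) ∨ x = (p, c p) := by
  obtain ⟨i, b⟩ := x
  simp only [levelJ, Prod.mk.injEq]
  by_cases h1 : i = p
  · subst h1; by_cases h3 : b = c i <;> simp [hp, h3]
  · by_cases h2 : i ∈ D <;> by_cases h3 : b = a i <;> simp [h1, h2, h3]

theorem levelJ_one {n : ℕ} (a c : Fin n → Bool) (p : Fin n) (D : Finset (Fin n))
    (x : JJ n) (h1 : x.1 ≠ p) : 1 ≤ levelJ a c p D x ↔ x.2 = a x.1 := by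
  obtain ⟨i, b⟩ := x
  simp only at h1
  simp only [levelJ]
  by_cases h2 : i ∈ D <;> by_cases h3 : b = a i <;> simp [h1, h2, h3]

/-- The exchange property needed. -/
theorem exchange {n : ℕ} {ℬ : Finset (Finset (JJ n))} (hM : IsLagrangianMatroid ℬ)
    (hT : ∀ A ∈ ℬ, IsTransversalJ A)
    (hP : ∀ A ∈ ℬ, ∀ B ∈ ℬ, (dS A B).card % 2 = 0)
    {A F : Finset (JJ n)} (hA : A ∈ ℬ) (hF : F ∈ ℬ) (hne : A ≠ F) :
    ∃ B ∈ ℬ, (dS A B).card = 2 ∧ dS A B ⊆ dS A F := by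
  obtain ⟨C, hC, hmin⟩ := Finset.exists_min_image
    (ℬ.filter fun B => B ≠ A ∧ dS A B ⊆ dS A F) (fun B => (dS A B).card)
    ⟨F, by simp [hF, hne.symm]⟩
  simp only [Finset.mem_filter] at hC hmin
  obtain ⟨hC, hCA, hCF⟩ := hC
  refine ⟨C, hC, ?_, hCF⟩
  by_contra hcard
  have hpos : (dS A C).card ≠ 0 := by
    intro h
    exact hCA (trans_ext (hT A hA) (hT C hC) (Finset.card_eq_zero.1 h)).symm
  have hev := hP A hA C hC
  have h3 : 2 < (dS A C).card := by omega
  obtain ⟨p, q, r, hp, hq, hr, hpq, hpr, hqr⟩ := Finset.two_lt_card_iff.1 h3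
  obtain ⟨w, hw, hmono⟩ := exists_perm
    (fun k => if k = p then 1 else if k ∈ dS A C then 0 else 2)
    (fun k => if k = p then chiS C k else chiS A k)
  set lvl : JJ n → ℤ := levelJ (chiS A) (chiS C) p (dS A C) with hlvl
  have hup : ∀ t : ℤ, ∀ x ∈ (Finset.univ.filter fun x => t ≤ lvl x), ∀ y, leW w x y →
      y ∈ (Finset.univ.filter fun x => t ≤ lvl x) := by
    intro t x hx y hxy
    simp only [Finset.mem_filter, Finset.mem_univ, true_and] at hx ⊢
    exact hx.trans (hmono x y hxy)
  obtain ⟨M, hMB, hMmax⟩ := hM.2 w hw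
  have hcount : ∀ t : ℤ, ∀ B ∈ ℬ, (B ∩ Finset.univ.filter fun x => t ≤ lvl x).card ≤
      (M ∩ Finset.univ.filter fun x => t ≤ lvl x).card :=
    fun t B hB => setLE_card (hMmax B hB) (hup t)
  have hfull : ∀ t : ℤ, ∀ B ∈ ℬ, (∀ x, t ≤ lvl x → x ∈ B) → ∀ x, t ≤ lvl x → x ∈ M := by
    intro t B hB h x hx
    have h1 : (B ∩ Finset.univ.filter fun x => t ≤ lvl x) =
        Finset.univ.filter fun x => t ≤ lvl x := by
      apply Finset.inter_eq_right.2
      intro y hy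
      exact h y (by simpa using hy)
    have h2 := hcount t B hB
    rw [h1] at h2
    have h3 := Finset.eq_of_subset_of_card_le Finset.inter_subset_right h2
    have : x ∈ (M ∩ Finset.univ.filter fun x => t ≤ lvl x) := by
      rw [h3]; simpa using hx
    exact (Finset.mem_inter.1 this).1
  have lvl3 : ∀ x, 3 ≤ lvl x ↔ x.1 ∉ dS A C ∧ x.2 = chiS A x.1 :=
    levelJ_three (chiS A) (chiS C) hp
  have lvl2 : ∀ x, 2 ≤ lvl x ↔ (x.1 ∉ dS A C ∧ x.2 = chiS A x.1) ∨ x = (p, chiS C p) :=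
    levelJ_two (chiS A) (chiS C) hp
  have lvl1 : ∀ x, x.1 ≠ p → (1 ≤ lvl x ↔ x.2 = chiS A x.1) :=
    levelJ_one (chiS A) (chiS C) p (dS A C)
  have hMsub : dS A M ⊆ dS A C := by
    intro k hk
    by_contra hk'
    have := hfull 3 A hA (by
      rintro ⟨i, b⟩ hx
      rw [hT A hA]
      exact ((lvl3 _).1 hx).2.symm) (k, chiS A k) ((lvl3 _).2 ⟨hk', rfl⟩)
    rw [hT M hMB] at this
    rw [mem_dS] at hk
    exact hk this.symm
  by_cases hMA : M = A
  · have := hfull 2 C hC (by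
      rintro ⟨i, b⟩ hx
      rw [hT C hC]
      rcases (lvl2 _).1 hx with ⟨h, h'⟩ | h
      · rw [mem_dS, not_not] at h
        rw [← h]; exact h'.symm
      · simp only [Prod.mk.injEq] at h
        rw [h.1, h.2]) (p, chiS C p) ((lvl2 _).2 (Or.inr rfl))
    rw [hMA, hT A hA] at this
    rw [mem_dS] at hp
    exact hp this
  · have h1 := hmin M ⟨hMB, hMA, hMsub.trans hCF⟩
    have h2 := Finset.eq_of_subset_of_card_le hMsub h1
    have hMC : M = C := by
      apply trans_ext (hT M hMB) (hT C hC)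
      ext k
      have : k ∈ dS A M ↔ k ∈ dS A C := by rw [h2]
      simp only [mem_dS] at this ⊢
      revert this
      cases chiS A k <;> cases chiS M k <;> cases chiS C k <;> simp
    have h4 := hcount 1 A hA
    rw [hMC] at h4
    set U3 := Finset.univ.filter fun x : JJ n => x.1 ∉ dS A C ∧ x.2 = chiS A x.1 with hU3
    have h5 : (C ∩ Finset.univ.filter fun x => 1 ≤ lvl x) ⊆ insert (p, chiS C p) U3 := by
      rintro ⟨i, b⟩ hx
      simp only [Finset.mem_inter, Finset.mem_filter, Finset.mem_univ, true_and] at hx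
      rw [hT C hC] at hx
      simp only [Finset.mem_insert, hU3, Finset.mem_filter, Finset.mem_univ, true_and,
        Prod.mk.injEq]
      by_cases hi : i = p
      · left; subst hi; exact ⟨rfl, hx.1.symm⟩
      · right
        have := (lvl1 (i, b) hi).1 hx.2
        simp only at this
        refine ⟨?_, this⟩
        rw [mem_dS, not_not, ← this, hx.1]
    have h6 : insert (q, chiS A q) (insert (r, chiS A r) U3) ⊆
        (A ∩ Finset.univ.filter fun x => 1 ≤ lvl x) := by
      rintro ⟨i, b⟩ hx
      simp only [Finset.mem_insert, hU3, Finset.mem_filter, Finset.mem_univ, true_and,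
        Prod.mk.injEq] at hx
      have hip : i ≠ p := by
        rintro rfl
        rcases hx with hx | hx | hx
        · exact hpq hx.1
        · exact hpr hx.1
        · exact hx.1 hp
      have hb : b = chiS A i := by
        rcases hx with hx | hx | hx
        · rw [hx.1, hx.2]
        · rw [hx.1, hx.2]
        · exact hx.2
      simp only [Finset.mem_inter, Finset.mem_filter, Finset.mem_univ, true_and]
      exact ⟨(hT A hA _ _).2 hb.symm, (lvl1 (i, b) hip).2 hb⟩
    have h7 := Finset.card_le_card h5
    have h8 := Finset.card_le_card h6
    have h9 := Finset.card_insert_le (p, chiS C p) U3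
    rw [Finset.card_insert_of_notMem, Finset.card_insert_of_notMem] at h8
    · omega
    · simp [hU3, hr]
    · simp [hU3, hq, hqr]

theorem eSet_apply {n : ℕ} {S : Finset (JJ n)} (hS : IsTransversalJ S) (k : Fin n) :
    eSet S k = if chiS S k then -1 else 1 := by
  unfold eSet
  rw [Finset.sum_apply, Finset.sum_eq_single (k, chiS S k)]
  · simp [eVec]
  · rintro ⟨i, b⟩ h hne
    simp only [eVec]
    rw [if_neg]
    rintro rfl
    rw [hS] at h
    exact hne (by rw [h])
  · intro h
    exact absurd ((hS _ _).2 rfl) h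

theorem longEdge_of {n : ℕ} {ℬ : Finset (Finset (JJ n))}
    (hT : ∀ A ∈ ℬ, IsTransversalJ A)
    (hP : ∀ A ∈ ℬ, ∀ B ∈ ℬ, (dS A B).card % 2 = 0)
    {A B : Finset (JJ n)} (hA : A ∈ ℬ) (hB : B ∈ ℬ) (h2 : (dS A B).card = 2) :
    IsLongEdge ℬ A B := by
  obtain ⟨i, j, hij, hD⟩ := Finset.card_eq_two.1 h2
  have hAB : A ≠ B := by
    rintro rfl
    rw [dS_self] at h2; simp at h2
  refine ⟨⟨hA, hB, hAB, ?_⟩, (i, true), (j, true), ?_, ?_, ?_⟩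
  · let wt : Fin n → ℝ := fun k => if k = i then 1 else if k = j then -1 else 2
    let L : (Fin n → ℝ) →ₗ[ℝ] ℝ :=
      ∑ k, (wt k * eSet A k) • (LinearMap.proj k : (Fin n → ℝ) →ₗ[ℝ] ℝ)
    have hL : ∀ S ∈ ℬ, L (eSet S) = ∑ k, wt k - 2 * ∑ k ∈ dS A S, wt k := by
      intro S hS
      have : L (eSet S) = ∑ k, wt k * eSet A k * eSet S k := by
        simp [L, LinearMap.sum_apply]
      rw [this, dS, Finset.sum_filter, Finset.mul_sum, ← Finset.sum_sub_distrib]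
      apply Finset.sum_congr rfl
      intro k _
      rw [eSet_apply (hT A hA), eSet_apply (hT S hS)]
      cases chiS A k <;> cases chiS S k <;> simp <;> ring
    refine ⟨L, ?_, ?_⟩
    · rw [hL A hA, hL B hB, dS_self, hD, Finset.sum_pair hij]
      simp [wt, hij.symm]
    · intro C hC hCA hCB
      rw [hL A hA, hL C hC, dS_self]
      have hex : ∃ k ∈ dS A C, k ≠ i ∧ k ≠ j := by
        by_contra hcon
        push Not at hcon
        have hsub : dS A C ⊆ dS A B := by
          intro k hk
          rw [hD]
          have := hcon k hk
          simp only [Finset.mem_insert, Finset.mem_singleton]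
          tauto
        have hev := hP A hA C hC
        have hle := Finset.card_le_card hsub
        by_cases h0 : (dS A C).card = 0
        · exact hCA (trans_ext (hT A hA) (hT C hC) (Finset.card_eq_zero.1 h0)).symm
        · have h2' := Finset.eq_of_subset_of_card_le hsub (by omega)
          apply hCB
          apply trans_ext (hT C hC) (hT B hB)
          ext k
          have : k ∈ dS A C ↔ k ∈ dS A B := by rw [h2']
          simp only [mem_dS] at this ⊢
          revert this
          cases chiS A k <;> cases chiS B k <;> cases chiS C k <;> simp
      obtain ⟨k, hk, hki, hkj⟩ := hex
      have hlow : ∑ l ∈ dS A C, ((if l = k then (2 : ℝ) else 0) + (if l = j then -1 else 0)) ≤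
          ∑ l ∈ dS A C, wt l := by
        apply Finset.sum_le_sum
        intro l _
        simp only [wt]
        by_cases h1 : l = i
        · subst h1; simp [hki.symm, hij]
        · by_cases h2 : l = j
          · subst h2; simp [hkj.symm, h1]
          · simp only [h1, h2, if_false]; split_ifs <;> norm_num
      rw [Finset.sum_add_distrib, Finset.sum_ite_eq', Finset.sum_ite_eq', if_pos hk] at hlow
      have : (-1 : ℝ) ≤ if j ∈ dS A C then -1 else 0 := by split_ifs <;> norm_num
      simp only [Finset.sum_empty]
      linarith
  · simpa using hij
  · simp [starJ]
  · ext ⟨k, b⟩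
    have : k ∈ dS A B ↔ k = i ∨ k = j := by rw [hD]; simp
    rw [mem_dS] at this
    simp only [Finset.mem_symmDiff, hT A hA k b, hT B hB k b, starJ, Finset.mem_insert,
      Finset.mem_singleton, Prod.mk.injEq]
    revert this
    cases chiS A k <;> cases chiS B k <;> cases b <;> simp

theorem dS_sub {n : ℕ} {A B : Finset (JJ n)} (hA : IsTransversalJ A) (hB : IsTransversalJ B)
    {k : Fin n} (hk : k ∈ dS A B) : (k, true) ∈ symmDiff A B := by
  rw [mem_dS] at hk
  rw [Finset.mem_symmDiff, hA, hB]
  revert hk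
  cases chiS A k <;> cases chiS B k <;> simp

theorem even_lagrangian_unique_orientation {n : ℕ}
    (ℬ : Finset (Finset (JJ n))) (hM : IsLagrangianMatroid ℬ)
    (hEven : ∀ A ∈ ℬ, ∀ B ∈ ℬ,
      (A.filter fun x => x.2).card % 2 = (B.filter fun x => x.2).card % 2) :
    (∃! s : Finset (JJ n) → Finset (JJ n) → ℤ, IsOrientation ℬ s) ∧
    (∀ F ∈ ℬ, ∀ A ∈ ℬ, heightF F A % 2 = 0) ∧
    (∀ s : Finset (JJ n) → Finset (JJ n) → ℤ, IsOrientation ℬ s →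
      ∀ F ∈ ℬ, ∀ A ∈ ℬ, s F A = (-1) ^ (heightF F A / 2)) := by
  have hT : ∀ A ∈ ℬ, IsTransversalJ A := fun A hA => isTrans_of (hM.1 A hA).1 (hM.1 A hA).2
  have hP : ∀ A ∈ ℬ, ∀ B ∈ ℬ, (dS A B).card % 2 = 0 := by
    intro A hA B hB
    have h1 := hEven A hA B hB
    rw [true_card (hT A hA), true_card (hT B hB)] at h1
    have h2 := dS_parity A B
    omega
  have hH : ∀ F ∈ ℬ, ∀ A ∈ ℬ, heightF F A = (dS F A).card :=
    fun F hF A hA => height_eq (hT F hF) (hT A hA)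
  have hHev : ∀ F ∈ ℬ, ∀ A ∈ ℬ, heightF F A % 2 = 0 := by
    intro F hF A hA
    rw [hH F hF A hA]; exact hP F hF A hA
  have huniq : ∀ s : Finset (JJ n) → Finset (JJ n) → ℤ, IsOrientation ℬ s →
      ∀ F ∈ ℬ, ∀ A ∈ ℬ, s F A = (-1) ^ (heightF F A / 2) := by
    intro s hs F hF
    obtain ⟨-, -, hvert, -, hone⟩ := hs.2.1 F hF
    have key : ∀ m : ℕ, ∀ A ∈ ℬ, heightF F A = m → s F A = (-1) ^ (heightF F A / 2) := by
      intro m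
      induction m using Nat.strong_induction_on with
      | _ m ih =>
        intro A hA hm
        by_cases hAF : A = F
        · subst hAF
          rw [hH A hA A hA, dS_self, hone]; simp
        · obtain ⟨B, hB, hc2, hsub⟩ := exchange hM hT hP hA hF hAF
          have hedge := longEdge_of hT hP hA hB hc2
          have hBF : dS F B = dS A F \ dS A B := by
            ext k
            have : k ∈ dS A B → k ∈ dS A F := fun h => hsub h
            simp only [Finset.mem_sdiff, mem_dS] at this ⊢
            revert this
            cases chiS A k <;> cases chiS B k <;> cases chiS F k <;> simp
          have hcard : (dS F B).card = (dS A F).card - 2 := by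
            rw [hBF, Finset.card_sdiff_of_subset hsub, hc2]
          have hge := Finset.card_le_card hsub
          rw [dS_comm A F] at hcard hge
          have hhA := hH F hF A hA
          have hhB := hH F hF B hB
          have hlt : heightF F A = heightF F B + 2 := by omega
          rw [hvert A B hedge (by omega), ih (heightF F B) (by omega) B hB rfl, hlt,
            Nat.add_div_right _ (by norm_num), pow_succ]
          ring
    intro A hA
    exact key _ A hA rfl
  refine ⟨?_, hHev, huniq⟩
  refine ⟨fun G A => if G ∈ ℬ ∧ A ∈ ℬ then (-1) ^ (heightF G A / 2) else 0, ⟨?_, ?_, ?_⟩, ?_⟩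
  · intro G A h
    simp only
    rw [if_neg]
    tauto
  · intro G hG
    refine ⟨?_, ?_, ?_, ?_, ?_⟩
    · intro A hA
      simp only [hG, hA, and_self, if_true]
      exact neg_one_pow_eq_or ℤ _
    · intro A B hE hh
      have hA := hE.1.1
      have hB := hE.1.2.1
      simp only [hG, hA, hB, and_self, if_true, hh]
    · intro A B hE hh
      have hA := hE.1.1
      have hB := hE.1.2.1
      simp only [hG, hA, hB, and_self, if_true]
      obtain ⟨-, i, j, -, -, hsd⟩ := hE
      have hsub : dS A B ⊆ {i.1, j.1} := by
        intro k hk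
        have := dS_sub (hT A hA) (hT B hB) hk
        rw [hsd] at this
        simp only [starJ, Finset.mem_insert, Finset.mem_singleton, Prod.ext_iff] at this ⊢
        tauto
      have hle := (Finset.card_le_card hsub).trans Finset.card_le_two
      have t1 := dS_triangle A G B
      have t2 := dS_triangle B G A
      have e1 := hHev G hG A hA
      have e2 := hHev G hG B hB
      rw [dS_comm A G] at t1
      rw [dS_comm B G, dS_comm B A] at t2
      have q1 := hH G hG A hA
      have q2 := hH G hG B hB
      have : heightF G A / 2 = heightF G B / 2 + 1 ∨ heightF G B / 2 = heightF G A / 2 + 1 := by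
        omega
      rcases this with h | h <;> rw [h, pow_succ] <;> ring
    · intro v hv
      exfalso
      obtain ⟨A, i, j, hij, h0, h1, -, -, hall⟩ := hv
      have hA := hall 0
      have hB := hall 1
      have hsd : symmDiff (v 0) (v 1) = {i, starJ i} := by
        rw [h0, h1, symmDiff_symmDiff_cancel_left]
      have hsub : dS (v 0) (v 1) ⊆ {i.1} := by
        intro k hk
        have := dS_sub (hT _ hA) (hT _ hB) hk
        rw [hsd] at this
        simp only [starJ, Finset.mem_insert, Finset.mem_singleton, Prod.ext_iff] at this ⊢
        tauto
      have hle := Finset.card_le_card hsub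
      rw [Finset.card_singleton] at hle
      have hev := hP _ hA _ hB
      have hz : (dS (v 0) (v 1)).card = 0 := by omega
      have heq := trans_ext (hT _ hA) (hT _ hB) (Finset.card_eq_zero.1 hz)
      rw [← heq, symmDiff_self] at hsd
      have : i ∈ (⊥ : Finset (JJ n)) := by rw [hsd]; simp
      simp at this
    · simp only [hG, and_self, if_true]
      rw [hH G hG G hG, dS_self]; simp
  · intro G hG H hH' A hA
    simp only [hG, hH', hA, and_self, if_true]
    rw [sdiff_card (hT G hG) (hT H hH') (hT A hA)]
    have t := dS_triangle G H A
    rw [dS_comm G H] at t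
    rw [← hH H hH' G hG, ← hH G hG A hA, ← hH H hH' A hA] at t
    have e1 := hHev G hG A hA
    have e2 := hHev H hH' G hG
    have e3 := hHev H hH' A hA
    set c := (Finset.univ.filter fun i => chiS G i ≠ chiS H i ∧ chiS G i ≠ chiS A i).card
    have hx : heightF H A / 2 + heightF H G / 2 + c =
        heightF G A / 2 + 2 * (heightF H G / 2) := by omega
    rw [← pow_add, ← pow_add, hx, pow_add, pow_mul]
    simp
  · intro s hs
    funext G A
    by_cases h : G ∈ ℬ ∧ A ∈ ℬ
    · rw [if_pos h]; exact huniq s hs G h.1 A h.2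
    · rw [if_neg h]; exact hs.1 G A (by tauto)
end

section
/- Let (M, s) be an oriented Lagrangian matroid and F a basis of M. Then the number of changes of sign of A ↦ s(F,A) along an increasing path from F to a basis of maximal height relative to F is the same for all such increasing paths (over all choices of admissible ordering or compatible linear functional, and over all terminal bases of maximal height). Hence the index of M relative to F is well defined. -/
open Finset Matrix
open scoped Classical

/-- An increasing path of length `p` in the matroid polytope starting at the
fundamental basis `F`: consecutive vertices are joined by edges and strictly increase
for some linear functional compatible with the height relative to `F`. -/
def IncreasingPath {n : ℕ} (ℬ : Finset (Finset (JJ n))) (F : Finset (JJ n))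
    (v : ℕ → Finset (JJ n)) (p : ℕ) : Prop :=
  v 0 = F ∧ (∀ i < p, IsEdge ℬ (v i) (v (i + 1))) ∧
  ∃ L : (Fin n → ℝ) →ₗ[ℝ] ℝ,
    (∀ A ∈ ℬ, ∀ B ∈ ℬ, heightF F B < heightF F A → L (eSet B) < L (eSet A)) ∧
    ∀ i < p, L (eSet (v i)) < L (eSet (v (i + 1)))

/-- A height-increasing path: consecutive vertices are adjacent in the polytope and
the height relative to `F` strictly increases. -/
def HeightIncreasingPath {n : ℕ} (ℬ : Finset (Finset (JJ n))) (F : Finset (JJ n))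
    (v : ℕ → Finset (JJ n)) (p : ℕ) : Prop :=
  v 0 = F ∧ ∀ i < p, IsEdge ℬ (v i) (v (i + 1)) ∧ heightF F (v i) < heightF F (v (i + 1))

/-- `A` is a basis of maximal height relative to `F`. -/
def MaxHeightBasis {n : ℕ} (ℬ : Finset (Finset (JJ n))) (F A : Finset (JJ n)) : Prop :=
  A ∈ ℬ ∧ ∀ B ∈ ℬ, heightF F B ≤ heightF F A

/-- The number of changes of sign of `sF` along the path `v 0, v 1, …, v p`. -/
def signChanges {n : ℕ} (sF : Finset (JJ n) → ℤ) (v : ℕ → Finset (JJ n)) (p : ℕ) : ℕ :=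
  ((Finset.range p).filter fun i => sF (v i) ≠ sF (v (i + 1))).card

/-- A 2-dimensional (exposed) face of the matroid polytope. -/
def Is2Face {n : ℕ} (ℬ : Finset (Finset (JJ n))) (Fc : Set (Fin n → ℝ)) : Prop :=
  IsExposed ℝ (matroidPolytope ℬ) Fc ∧ Module.finrank ℝ (vectorSpan ℝ Fc) = 2

/-- `v 0, …, v (m-1)` is the cycle of vertices (bases) of the 2-dimensional face `Fc`
of the matroid polytope, consecutive ones (cyclically) being joined by edges. -/
def FaceCycle {n : ℕ} (ℬ : Finset (Finset (JJ n))) (Fc : Set (Fin n → ℝ)) (m : ℕ)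
    (v : ℕ → Finset (JJ n)) : Prop :=
  Is2Face ℬ Fc ∧ 3 ≤ m ∧ (∀ i < m, v i ∈ ℬ ∧ eSet (v i) ∈ Fc) ∧
  (∀ A ∈ ℬ, eSet A ∈ Fc → ∃! i : ℕ, i < m ∧ v i = A) ∧
  ∀ i < m, IsEdge ℬ (v i) (v ((i + 1) % m))

/-- An orientation of the Lagrangian matroid polytope: an assignment `ε` of directions
to short edges (`ε A B = 1` when the edge is directed from `A` to `B`; `ε` vanishes on
non-(short edges)) such that in every 2-dimensional face the number of short edges
directed clockwise equals the number directed anti-clockwise. -/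
def IsPolytopeOrientation {n : ℕ} (ℬ : Finset (Finset (JJ n)))
    (ε : Finset (JJ n) → Finset (JJ n) → ℤ) : Prop :=
  (∀ A B : Finset (JJ n), IsShortEdge ℬ A B → (ε A B = 1 ∨ ε A B = -1) ∧ ε B A = -ε A B) ∧
  (∀ A B : Finset (JJ n), ¬IsShortEdge ℬ A B → ε A B = 0) ∧
  ∀ (Fc : Set (Fin n → ℝ)) (m : ℕ) (v : ℕ → Finset (JJ n)), FaceCycle ℬ Fc m v →
    (∑ i ∈ Finset.range m, ε (v i) (v ((i + 1) % m))) = 0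

/-- An inducing edge relative to `F`, for the polytope orientation `ε`: a vertical long
edge, or a short edge directed downwards (from the higher basis to the lower one). -/
def IsInducingEdge {n : ℕ} (ℬ : Finset (Finset (JJ n)))
    (ε : Finset (JJ n) → Finset (JJ n) → ℤ) (F A B : Finset (JJ n)) : Prop :=
  (IsLongEdge ℬ A B ∧ heightF F A ≠ heightF F B) ∨
  (IsShortEdge ℬ A B ∧
    ((heightF F B < heightF F A ∧ ε A B = 1) ∨ (heightF F A < heightF F B ∧ ε B A = 1)))

/-- The signs `s` are induced from the polytope orientation `ε`: for every fundamental
basis `F`, `s F F = 1`, bases joined by an inducing edge get opposite signs, and bases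
joined by a non-inducing edge get the same sign. -/
def InducedBy {n : ℕ} (ℬ : Finset (Finset (JJ n)))
    (ε : Finset (JJ n) → Finset (JJ n) → ℤ)
    (s : Finset (JJ n) → Finset (JJ n) → ℤ) : Prop :=
  ∀ F ∈ ℬ, s F F = 1 ∧ ∀ A B : Finset (JJ n), IsEdge ℬ A B →
    (IsInducingEdge ℬ ε F A B → s F A = -s F B) ∧
    (¬IsInducingEdge ℬ ε F A B → s F A = s F B)


section comb
variable {ι : Type*} [DecidableEq ι]

/-- symmetric exchange -/
def Exch (D : Finset ι → Prop) : Prop :=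
  ∀ X Y, D X → D Y → ∀ i ∈ symmDiff X Y, ∃ j ∈ symmDiff X Y, D (symmDiff X {i, j})

/-- proper nonempty members below `T` -/
def Mid (D : Finset ι → Prop) (T B : Finset ι) : Prop := D B ∧ B.Nonempty ∧ B ⊆ T ∧ B ≠ T

/-- local constancy -/
def LocC (D : Finset ι → Prop) (T : Finset ι) (f : Finset ι → ℤ) : Prop :=
  ∀ B B', Mid D T B → Mid D T B' → (B ∩ B').Nonempty → B ∪ B' ≠ T → f B = f B'

lemma ex_bot {D : Finset ι → Prop} (h : Exch D) (h0 : D ∅) {B : Finset ι} (hB : D B) {i : ι}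
    (hi : i ∈ B) : ∃ j ∈ B, D {i, j} := by
  have := h ∅ B h0 hB i (by simpa [mem_symmDiff] using hi)
  have e : ∀ C : Finset ι, symmDiff ∅ C = C := fun C => by ext x; simp [mem_symmDiff]
  simpa only [e] using this

lemma ex_down {D : Finset ι → Prop} (h : Exch D) (h0 : D ∅) {B : Finset ι} (hB : D B) {i : ι}
    (hi : i ∈ B) : ∃ j ∈ B, D (B \ {i, j}) := by
  obtain ⟨j, hj, h1⟩ := h B ∅ hB h0 i (by simpa [mem_symmDiff] using hi)
  have hj : j ∈ B := by simpa [mem_symmDiff] using hj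
  refine ⟨j, hj, ?_⟩
  convert h1 using 1
  ext x; simp only [mem_sdiff, mem_symmDiff, mem_insert, mem_singleton]; grind

lemma ex_up {D : Finset ι → Prop} (h : Exch D) {T : Finset ι} (hT : D T) {B : Finset ι}
    (hB : D B) (hBT : B ⊆ T) {i : ι}
    (hi : i ∈ T) (hi' : i ∉ B) : ∃ j ∈ T, j ∉ B ∧ D (B ∪ {i, j}) := by
  obtain ⟨j, hj, h1⟩ := h B T hB hT i (by simp [mem_symmDiff]; grind)
  have hj : j ∈ T ∧ j ∉ B := by
    simp only [mem_symmDiff] at hj; grind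
  refine ⟨j, hj.1, hj.2, ?_⟩
  convert h1 using 1
  ext x; simp only [mem_union, mem_symmDiff, mem_insert, mem_singleton]; grind

lemma card_ne_of_lt {A T : Finset ι} (h : A.card < T.card) : A ≠ T := by
  rintro rfl; exact lt_irrefl _ h

/-- every middle element sees a small one -/
lemma atom {D : Finset ι → Prop} (h : Exch D) (h0 : D ∅) {T : Finset ι} {f : Finset ι → ℤ}
    (hf : LocC D T f) {B : Finset ι} (hB : Mid D T B) :
    ∃ a, Mid D T a ∧ a.card ≤ 2 ∧ f B = f a := by
  obtain ⟨h1, ⟨i, hi⟩, h3, h4⟩ := hB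
  obtain ⟨j, hj, h5⟩ := ex_bot h h0 h1 hi
  have hs : ({i, j} : Finset ι) ⊆ B := by grind
  have hm : Mid D T {i, j} := ⟨h5, by simp, hs.trans h3, by
    rintro h; rw [h] at hs; exact h4 (subset_antisymm h3 hs)⟩
  refine ⟨{i, j}, hm, card_le_two, hf _ _ ⟨h1, ⟨i, hi⟩, h3, h4⟩ hm ⟨i, by simp [hi]⟩ ?_⟩
  rw [union_eq_left.2 hs]; exact h4

lemma stepA {D : Finset ι → Prop} (h : Exch D) {T : Finset ι} (hT : D T)
    {f : Finset ι → ℤ} (hf : LocC D T f) {a : Finset ι} (ha : Mid D T a)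
    (c1 : a.card + 2 < T.card) {i : ι} (hi : i ∈ T) (hia : i ∉ a) :
    ∃ j ∈ T, j ∉ a ∧ Mid D T (a ∪ {i, j}) ∧ f a = f (a ∪ {i, j}) := by
  obtain ⟨j, hjT, hja, hD⟩ := ex_up h hT ha.1 ha.2.2.1 hi hia
  have hc : (a ∪ {i, j}).card < T.card :=
    lt_of_le_of_lt ((card_union_le _ _).trans (Nat.add_le_add_left card_le_two _)) c1
  have hm : Mid D T (a ∪ {i, j}) := ⟨hD, by simp, by
    have := ha.2.2.1; grind, card_ne_of_lt hc⟩
  refine ⟨j, hjT, hja, hm, hf _ _ ha hm ?_ ?_⟩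
  · obtain ⟨x, hx⟩ := ha.2.1
    exact ⟨x, by simp [hx]⟩
  · rw [union_eq_right.2 subset_union_left]; exact card_ne_of_lt hc

lemma conn5 {D : Finset ι → Prop} (h : Exch D) (h0 : D ∅) {T : Finset ι} (hT : D T)
    (h5 : 5 ≤ T.card) {f : Finset ι → ℤ} (hf : LocC D T f) {a a' : Finset ι}
    (ha : Mid D T a) (ha' : Mid D T a') (hc : a.card ≤ 2) (hc' : a'.card ≤ 2) : f a = f a' := by
  by_cases hd : (a ∩ a').Nonempty
  · exact hf _ _ ha ha' hd (card_ne_of_lt (by have := card_union_le a a'; omega))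
  rw [not_nonempty_iff_eq_empty, ← disjoint_iff_inter_eq_empty] at hd
  by_contra hne
  have key : ∀ a a' : Finset ι, Mid D T a → Mid D T a' → a.card ≤ 2 → a'.card ≤ 2 →
      Disjoint a a' → f a ≠ f a' → ∀ i ∈ a', ∃ j, j ∈ T ∧ j ∉ a ∧ j ∉ a' ∧ a ∪ a' ∪ {j} = T ∧
        Mid D T (a ∪ {i, j}) ∧ f a = f (a ∪ {i, j}) := by
    intro a a' ha ha' hc hc' hd hne i hi
    obtain ⟨j, hjT, hja, hm, hfe⟩ := stepA h hT hf ha (by omega) (ha'.2.2.1 hi)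
      (fun hia => (Finset.disjoint_left.1 hd hia hi))
    have hu : a ∪ {i, j} ∪ a' = T := by
      by_contra hu
      exact hne (hfe.trans (hf _ _ hm ha' ⟨i, by simp [hi]⟩ hu))
    have hu' : a ∪ a' ∪ {j} = T := by
      rw [← hu]; ext x; simp only [mem_union, mem_insert, mem_singleton]; grind
    have hja' : j ∉ a' := by
      intro hj
      have : a ∪ a' ∪ {j} = a ∪ a' := by
        rw [union_eq_left]; grind
      rw [this] at hu'
      have := card_union_le a a'
      rw [hu'] at this; omega
    exact ⟨j, hjT, hja, hja', hu', hm, hfe⟩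
  obtain ⟨i, hi⟩ := ha'.2.1
  obtain ⟨x, hx⟩ := ha.2.1
  obtain ⟨j, hjT, hja, hja', hu, hm, hfe⟩ := key a a' ha ha' hc hc' hd hne i hi
  obtain ⟨k, hk, hkD⟩ := ex_down h h0 hm.1 (i := x) (by simp [hx])
  have hca : a.card = 2 := by
    have h1 := card_union_le (a ∪ a') {j}
    have h2 := card_union_le a a'
    rw [hu, card_singleton] at h1; omega
  have hia : i ∉ a := fun hia => (Finset.disjoint_left.1 hd hia hi)
  have hij : i ≠ j := by rintro rfl; exact hja' hi
  obtain ⟨y, hya, hyx⟩ : ∃ y ∈ a, y ≠ x := by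
    have : 1 < a.card := by omega
    obtain ⟨y, hy, hyx⟩ := exists_mem_ne this x
    exact ⟨y, hy, hyx⟩
  have haeq : a = {x, y} := by
    symm; apply eq_of_subset_of_card_le
    · grind
    · rw [card_pair hyx.symm]; omega
  obtain ⟨j2, hjT2, hja2, hja2', hu2, hm2, hfe2⟩ := key a' a ha' ha hc' hc hd.symm (Ne.symm hne) y hya
  have hj2 : j2 = j := by
    have : j2 ∈ a ∪ a' ∪ {j} := by rw [hu]; exact hjT2
    simp only [mem_union, mem_singleton] at this; tauto
  subst hj2
  have hsub1 : (a ∪ {i, j2}) \ {x, k} ⊆ a ∪ {i, j2} := sdiff_subset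
  have hsub2 : (a ∪ {i, j2}) \ {x, k} ⊆ a' ∪ {y, j2} := by
    intro z; rw [haeq]; simp only [mem_union, mem_sdiff, mem_insert, mem_singleton]; grind
  have hne' : ((a ∪ {i, j2}) \ {x, k}).Nonempty := by
    by_cases hki : k = i
    · exact ⟨j2, by simp only [mem_union, mem_sdiff, mem_insert, mem_singleton]; grind⟩
    · exact ⟨i, by simp only [mem_union, mem_sdiff, mem_insert, mem_singleton]; grind⟩
  have hmc : Mid D T ((a ∪ {i, j2}) \ {x, k}) := ⟨hkD, hne', hsub1.trans hm.2.2.1, by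
    intro he; rw [he] at hsub1; exact hm.2.2.2 (subset_antisymm hm.2.2.1 hsub1)⟩
  have e1 := hf _ _ hmc hm (by rwa [inter_eq_left.2 hsub1]) (by
    rw [union_eq_right.2 hsub1]; exact hm.2.2.2)
  have e2 := hf _ _ hmc hm2 (by rwa [inter_eq_left.2 hsub2]) (by
    rw [union_eq_right.2 hsub2]; exact hm2.2.2.2)
  exact hne (by rw [hfe, ← e1, e2, ← hfe2])

lemma conn4 {D : Finset ι → Prop} (h : Exch D) (h0 : D ∅) {T : Finset ι} (hT : D T)
    (h4 : T.card = 4) {f : Finset ι → ℤ} (hf : LocC D T f) {x : ι} {a' : Finset ι}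
    (ha : Mid D T {x}) (ha' : Mid D T a') (hc' : a'.card ≤ 2) : f {x} = f a' := by
  have hxT : x ∈ T := by have := ha.2.2.1; grind
  by_cases hd : x ∈ a'
  · exact hf _ _ ha ha' ⟨x, by simp [hd]⟩ (card_ne_of_lt (by
      have := card_union_le {x} a'; rw [card_singleton] at this; omega))
  by_contra hne
  have key : ∀ i ∈ a', ∃ j ∈ T, j ≠ x ∧ j ∉ a' ∧ insert x (insert j a') = T ∧
      Mid D T {x, i, j} ∧ f {x} = f {x, i, j} := by
    intro i hi
    obtain ⟨j, hjT, hja, hm, hfe⟩ := stepA h hT hf ha (by simp [h4]) (ha'.2.2.1 hi)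
      (by simp; rintro rfl; exact hd hi)
    have e : ({x} ∪ {i, j} : Finset ι) = {x, i, j} := rfl
    rw [e] at hm hfe
    have hu : {x, i, j} ∪ a' = T := by
      by_contra hu
      exact hne (hfe.trans (hf _ _ hm ha' ⟨i, by simp [hi]⟩ hu))
    have hu' : insert x (insert j a') = T := by
      rw [← hu]; ext x; simp only [mem_union, mem_insert, mem_singleton]; grind
    refine ⟨j, hjT, by simpa using hja, ?_, hu', hm, hfe⟩
    intro hj
    rw [insert_eq_of_mem hj] at hu'
    have := card_insert_le x a'
    rw [hu'] at this; omega
  obtain ⟨y, hy⟩ := ha'.2.1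
  obtain ⟨w, hwT, hwx, hwa, hTe, hm, hfe⟩ := key y hy
  have hca : a'.card = 2 := by
    have h1 := card_insert_le x (insert w a')
    have h2 := card_insert_le w a'
    rw [hTe] at h1; omega
  obtain ⟨z, hz, hzy⟩ := exists_mem_ne (by omega : 1 < a'.card) y
  have haeq : a' = {y, z} := by
    symm; apply eq_of_subset_of_card_le
    · grind
    · rw [card_pair hzy.symm]; omega
  obtain ⟨w', hwT', hwx', hwa', hTe', hm', hfe'⟩ := key z hz
  have hww : w' = w := by
    rw [← hTe] at hwT'; simp only [mem_insert] at hwT'; tauto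
  subst hww
  subst haeq
  have hxy : x ≠ y := by grind
  have hxz : x ≠ z := by grind
  have hwy : w' ≠ y := by grind
  have hwz : w' ≠ z := by grind
  subst hTe
  obtain ⟨k, hk, hkD⟩ := ex_down h h0 hm'.1 (i := x) (by simp)
  have hsub1 : ({x, z, w'} : Finset ι) \ {x, k} ⊆ {x, z, w'} := sdiff_subset
  have hne' : (({x, z, w'} : Finset ι) \ {x, k}).Nonempty := by
    by_cases hki : k = z
    · exact ⟨w', by simp only [mem_sdiff, mem_insert, mem_singleton]; grind⟩
    · exact ⟨z, by simp only [mem_sdiff, mem_insert, mem_singleton]; grind⟩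
  have hmc : Mid D _ (({x, z, w'} : Finset ι) \ {x, k}) := ⟨hkD, hne', hsub1.trans hm'.2.2.1, by
    intro he; rw [he] at hsub1; exact hm'.2.2.2 (subset_antisymm hm'.2.2.1 hsub1)⟩
  have e1 := hf _ _ hmc hm' (by rwa [inter_eq_left.2 hsub1]) (by
    rw [union_eq_right.2 hsub1]; exact hm'.2.2.2)
  have nx : ∀ U : Finset ι, x ∉ U → U ≠ insert x (insert w' {y, z}) := by
    rintro U hU rfl; simp at hU
  by_cases hkz : k = z
  · have e : ({x, z, w'} : Finset ι) \ {x, k} = {w'} := by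
      ext t; simp only [mem_sdiff, mem_insert, mem_singleton]; grind
    rw [e] at e1 hmc
    obtain ⟨l, hl, hlD⟩ := h {w'} {y, z} hmc.1 ha'.1 y (by simp [mem_symmDiff]; grind)
    have hl' : l = w' ∨ l = y ∨ l = z := by
      simp only [mem_symmDiff, mem_insert, mem_singleton] at hl; grind
    have cont : ∀ U : Finset ι, D U → y ∈ U → w' ∈ U → U ⊆ {w', y, z} → False := by
      intro U hU hyU hwU hs
      have hxU : x ∉ U := by intro hx; have := hs hx; simp at this; grind
      have hmU : Mid D (insert x (insert w' {y, z})) U := ⟨hU, ⟨y, hyU⟩, by grind, nx _ hxU⟩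
      have a1 := hf _ _ hmU ha' ⟨y, by simp [hyU]⟩ (nx _ (by simp; grind))
      have a2 := hf _ _ hmU hmc ⟨w', by simp [hwU]⟩ (nx _ (by simp; grind))
      exact hne (by rw [hfe', ← e1, ← a2, a1])
    rcases hl' with rfl | rfl | rfl
    · have e : symmDiff {l} {y, l} = ({y} : Finset ι) := by
        ext t; simp only [mem_symmDiff, mem_insert, mem_singleton]; grind
      rw [e] at hlD
      have hmU : Mid D (insert x (insert l {y, z})) {y} :=
        ⟨hlD, by simp, by grind, nx _ (by simpa using hxy)⟩
      have a1 := hf _ _ hmU ha' ⟨y, by simp⟩ (nx _ (by simp; grind))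
      have a2 := hf _ _ hmU hm ⟨y, by simp⟩ (by
        have : ({y} ∪ {x, y, l} : Finset ι) = {x, y, l} := by ext t; simp
        rw [this]; exact hm.2.2.2)
      exact hne (by rw [hfe, ← a2, a1])
    · exact cont _ hlD (by simp [mem_symmDiff]; grind) (by simp [mem_symmDiff]; grind)
        (by intro t; simp only [mem_symmDiff, mem_insert, mem_singleton]; grind)
    · exact cont _ hlD (by simp [mem_symmDiff]; grind) (by simp [mem_symmDiff]; grind)
        (by intro t; simp only [mem_symmDiff, mem_insert, mem_singleton]; grind)
  · have hzc : z ∈ ({x, z, w'} : Finset ι) \ {x, k} := by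
      simp only [mem_sdiff, mem_insert, mem_singleton]; grind
    have a1 := hf _ _ hmc ha' ⟨z, by rw [mem_inter]; exact ⟨hzc, by simp⟩⟩ (nx _ (by simp; grind))
    exact hne (by rw [hfe', ← e1, a1])
end comb

section pot
variable {ι : Type*} [DecidableEq ι]

/-- closed 1-cochain data on a delta-matroid -/
structure Cochain (D : Finset ι → Prop) (d : Finset ι → Finset ι → ℤ) : Prop where
  exch : Exch D
  anti : ∀ X i, D X → D (symmDiff X {i}) → d (symmDiff X {i}) X = - d X (symmDiff X {i})
  sq : ∀ X i j, i ≠ j → D X → D (symmDiff X {i}) → D (symmDiff X {j}) → D (symmDiff X {i, j}) →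
    d X (symmDiff X {i}) + d (symmDiff X {i}) (symmDiff X {i, j}) =
    d X (symmDiff X {j}) + d (symmDiff X {j}) (symmDiff X {i, j})
  tri : ∀ X i j, i ≠ j → D X → D (symmDiff X {i}) → ¬ D (symmDiff X {j}) → D (symmDiff X {i, j}) →
    d X (symmDiff X {i}) + d (symmDiff X {i}) (symmDiff X {i, j}) = 0
  rect : ∀ X i j k, i ≠ j → i ≠ k → j ≠ k → D X → D (symmDiff X {i}) → D (symmDiff X {j, k}) →
    D (symmDiff X {i, j, k}) → ¬ D (symmDiff X {j}) → ¬ D (symmDiff X {k}) →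
    ¬ D (symmDiff X {i, j}) → ¬ D (symmDiff X {i, k}) →
    d X (symmDiff X {i}) = d (symmDiff X {j, k}) (symmDiff X {i, j, k})

structure Good (D : Finset ι → Prop) (d : Finset ι → Finset ι → ℤ) (k : ℕ)
    (δ : Finset ι → Finset ι → ℤ) : Prop where
  add : ∀ X Y Z, D X → D Y → D Z → (symmDiff X Y ∪ symmDiff X Z).card ≤ k →
    δ X Y + δ Y Z = δ X Z
  short : ∀ X i, D X → D (symmDiff X {i}) → δ X (symmDiff X {i}) = d X (symmDiff X {i})
  long : 2 ≤ k → ∀ X i j, i ≠ j → D X → D (symmDiff X {i, j}) →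
    ¬ (D (symmDiff X {i}) ∧ D (symmDiff X {j})) → δ X (symmDiff X {i, j}) = 0

variable {D : Finset ι → Prop} {d δ : Finset ι → Finset ι → ℤ} {k : ℕ}

lemma Good.self (h : Good D d k δ) {X} (hX : D X) : δ X X = 0 := by
  have := h.add X X X hX hX hX (by simp); omega

lemma Good.neg (h : Good D d k δ) {X Y} (hX : D X) (hY : D Y) (hc : (symmDiff X Y).card ≤ k) :
    δ Y X = - δ X Y := by
  have := h.add X Y X hX hY hX (by simpa using hc)
  rw [h.self hX] at this; omega

/-- translate -/
def Tr (D : Finset ι → Prop) (X : Finset ι) : Finset ι → Prop := fun B => D (symmDiff X B)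

/-- two step value -/
def ff (δ : Finset ι → Finset ι → ℤ) (X T B : Finset ι) : ℤ :=
  δ X (symmDiff X B) + δ (symmDiff X B) (symmDiff X T)

lemma exch_tr (h : Exch D) (X : Finset ι) : Exch (Tr D X) := by
  intro A B hA hB i hi
  have e : symmDiff (symmDiff X A) (symmDiff X B) = symmDiff A B := by
    ext x; simp only [mem_symmDiff]; tauto
  obtain ⟨j, hj, hD⟩ := h _ _ hA hB i (by rwa [e])
  rw [e] at hj
  rw [symmDiff_assoc] at hD
  exact ⟨j, hj, hD⟩

lemma tr_empty {X : Finset ι} (hX : D X) : Tr D X ∅ := by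
  have : symmDiff X ∅ = X := by ext x; simp [mem_symmDiff]
  rw [Tr, this]; exact hX

lemma locC (h : Good D d k δ) {X T : Finset ι} (hX : D X) (hT : D (symmDiff X T))
    (hc : T.card = k + 1) : LocC (Tr D X) T (ff δ X T) := by
  intro B B' hB hB' hi hu
  have hs := hB.2.2.1
  have hs' := hB'.2.2.1
  have c1 : (B ∪ B').card ≤ k := by
    have := card_lt_card (ssubset_of_subset_of_ne (union_subset hs hs') hu); omega
  have c2 : (T \ (B ∩ B')).card ≤ k := by
    have := card_lt_card (sdiff_ssubset (inter_subset_left.trans hs : B ∩ B' ⊆ T) hi); omega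
  have a1 := h.add X (symmDiff X B) (symmDiff X B') hX hB.1 hB'.1 (by
    refine le_trans (card_le_card ?_) c1
    intro x; simp only [mem_union, mem_symmDiff]; tauto)
  have a2 := h.add (symmDiff X B) (symmDiff X B') (symmDiff X T) hB.1 hB'.1 hT (by
    refine le_trans (card_le_card ?_) c2
    intro x
    have := @hs x
    have := @hs' x
    simp only [mem_union, mem_symmDiff, mem_sdiff, mem_inter]; tauto)
  unfold ff; omega

/-- well-definedness -/
def WD (D : Finset ι → Prop) (δ : Finset ι → Finset ι → ℤ) (X T : Finset ι) : Prop :=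
  ∀ B B', Mid (Tr D X) T B → Mid (Tr D X) T B' → ff δ X T B = ff δ X T B'

lemma sd_compl {X T B : Finset ι} (h : B ⊆ T) :
    symmDiff (symmDiff X T) (T \ B) = symmDiff X B := by
  ext x; have := @h x; simp only [mem_symmDiff, mem_sdiff]; tauto

lemma sd_twice {X T : Finset ι} : symmDiff (symmDiff X T) T = X := by
  ext x; simp only [mem_symmDiff]; tauto

lemma mid_dual {X T B : Finset ι} (h : Mid (Tr D X) T B) :
    Mid (Tr D (symmDiff X T)) T (T \ B) := by
  obtain ⟨h1, h2, h3, h4⟩ := h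
  refine ⟨?_, ?_, sdiff_subset, ?_⟩
  · rw [Tr, sd_compl h3]; exact h1
  · rw [sdiff_nonempty]; intro h; exact h4 (subset_antisymm h3 h)
  · exact (sdiff_ssubset h3 h2).ne

lemma ff_dual (h : Good D d k δ) {X T B : Finset ι} (hX : D X) (hT : D (symmDiff X T))
    (hc : T.card = k + 1) (hB : Mid (Tr D X) T B) :
    ff δ (symmDiff X T) T (T \ B) = - ff δ X T B := by
  unfold ff
  rw [sd_compl hB.2.2.1, sd_twice]
  have c1 : B.card ≤ k := by
    have := card_lt_card (ssubset_of_subset_of_ne hB.2.2.1 hB.2.2.2); omega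
  have c2 : (T \ B).card ≤ k := by
    have := card_lt_card (sdiff_ssubset hB.2.2.1 hB.2.1); omega
  rw [h.neg hX hB.1 (by rwa [symmDiff_symmDiff_cancel_left]), h.neg hB.1 hT ?_]
  · ring
  · refine le_trans (card_le_card ?_) c2
    intro x
    have := @hB.2.2.1 x
    simp only [mem_symmDiff, mem_sdiff]; tauto

lemma wd_dual (h : Good D d k δ) {X T : Finset ι} (hX : D X) (hT : D (symmDiff X T))
    (hc : T.card = k + 1) (hw : WD D δ (symmDiff X T) T) : WD D δ X T := by
  intro B B' hB hB'
  have := hw _ _ (mid_dual hB) (mid_dual hB')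
  rw [ff_dual h hX hT hc hB, ff_dual h hX hT hc hB'] at this
  omega

lemma wd5 (hC : Cochain D d) (h : Good D d k δ) {X T : Finset ι} (hX : D X)
    (hT : D (symmDiff X T)) (hc : T.card = k + 1) (hk : 4 ≤ k) : WD D δ X T := by
  intro B B' hB hB'
  have hl := locC h hX hT hc
  obtain ⟨a, ha, hac, e⟩ := atom (exch_tr hC.exch X) (tr_empty hX) hl hB
  obtain ⟨a', ha', hac', e'⟩ := atom (exch_tr hC.exch X) (tr_empty hX) hl hB'
  rw [e, e']
  exact conn5 (exch_tr hC.exch X) (tr_empty hX) hT (by omega) hl ha ha' hac hac'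

lemma wd4a (hC : Cochain D d) (h : Good D d 3 δ) {X T : Finset ι} (hX : D X)
    (hT : D (symmDiff X T)) (hc : T.card = 4) {x : ι} (hx : Mid (Tr D X) T {x}) : WD D δ X T := by
  have hl := locC h hX hT hc
  have : ∀ B, Mid (Tr D X) T B → ff δ X T {x} = ff δ X T B := by
    intro B hB
    obtain ⟨a, ha, hac, e⟩ := atom (exch_tr hC.exch X) (tr_empty hX) hl hB
    rw [e]
    exact conn4 (exch_tr hC.exch X) (tr_empty hX) hT hc hl hx ha hac
  intro B B' hB hB'
  rw [← this B hB, ← this B' hB']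

lemma wd4 (hC : Cochain D d) (h : Good D d 3 δ) {X T : Finset ι} (hX : D X)
    (hT : D (symmDiff X T)) (hc : T.card = 4) : WD D δ X T := by
  by_cases h1 : ∃ x, Mid (Tr D X) T {x}
  · obtain ⟨x, hx⟩ := h1; exact wd4a hC h hX hT hc hx
  by_cases h2 : ∃ x, Mid (Tr D (symmDiff X T)) T {x}
  · obtain ⟨x, hx⟩ := h2
    exact wd_dual h hX hT hc (wd4a hC h hT (by rw [sd_twice]; exact hX) hc hx)
  have : ∀ B, Mid (Tr D X) T B → ff δ X T B = 0 := by
    intro B hB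
    have b1 : B.card ≠ 1 := by
      intro hb; obtain ⟨x, rfl⟩ := card_eq_one.1 hb; exact h1 ⟨x, hB⟩
    have b2 : (T \ B).card ≠ 1 := by
      intro hb; obtain ⟨x, hx⟩ := card_eq_one.1 hb
      exact h2 ⟨x, by rw [← hx]; exact mid_dual hB⟩
    have b3 := card_lt_card (ssubset_of_subset_of_ne hB.2.2.1 hB.2.2.2)
    have b4 := card_pos.2 hB.2.1
    rw [card_sdiff_of_subset hB.2.2.1] at b2
    have b5 : B.card = 2 := by omega
    have b6 : (T \ B).card = 2 := by rw [card_sdiff_of_subset hB.2.2.1]; omega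
    obtain ⟨y, z, hyz, rfl⟩ := card_eq_two.1 b5
    obtain ⟨u, w, huw, hTB⟩ := card_eq_two.1 b6
    have hyT : y ∈ T := hB.2.2.1 (by simp)
    have huT : u ∈ T \ {y, z} := by rw [hTB]; simp
    have hwT : w ∈ T \ {y, z} := by rw [hTB]; simp
    rw [mem_sdiff] at huT hwT
    have hTe : T = {y, z} ∪ {u, w} := by rw [← hTB, union_sdiff_of_subset hB.2.2.1]
    have e1 : δ X (symmDiff X {y, z}) = 0 := by
      apply h.long (by norm_num) X y z hyz hX hB.1
      rintro ⟨hy, -⟩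
      exact h1 ⟨y, hy, by simp, by simpa using hyT, card_ne_of_lt (by simp [hc])⟩
    have hTT : symmDiff X T = symmDiff (symmDiff X {y, z}) {u, w} := by
      rw [hTe]; ext x
      simp only [mem_symmDiff, mem_union, mem_insert, mem_singleton]; grind
    have e2 : δ (symmDiff X {y, z}) (symmDiff X T) = 0 := by
      rw [hTT]
      apply h.long (by norm_num) _ u w huw hB.1 (by rw [← hTT]; exact hT)
      rintro ⟨hu, -⟩
      refine h2 ⟨w, ?_, by simp, by simpa using hwT.1, card_ne_of_lt (by simp [hc])⟩
      unfold Tr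
      convert hu using 1
      rw [hTT]; ext x
      simp only [mem_symmDiff, mem_insert, mem_singleton]; grind
    unfold ff; omega
  intro B B' hB hB'
  rw [this B hB, this B' hB']

lemma wd3s (h : Good D d 2 δ) {X T : Finset ι} (hX : D X)
    (hT : D (symmDiff X T)) (hc : T.card = 3) {x y : ι} (hxy : x ≠ y)
    (hx : Mid (Tr D X) T {x}) (hy : Mid (Tr D X) T {y}) : ff δ X T {x} = ff δ X T {y} := by
  have hl := locC h hX hT hc
  have hxT : x ∈ T := hx.2.2.1 (by simp)
  have hyT : y ∈ T := hy.2.2.1 (by simp)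
  have hn : ({x, y} : Finset ι) ≠ T := card_ne_of_lt (by rw [card_pair hxy, hc]; norm_num)
  by_cases hD : Tr D X {x, y}
  · have hm : Mid (Tr D X) T {x, y} := ⟨hD, by simp, by grind, hn⟩
    rw [hl _ _ hx hm (by simp) (by simpa using hn), hl _ _ hy hm (by simp) (by simpa using hn)]
  · have hsub : ({x, y} : Finset ι) ⊆ T := by grind
    obtain ⟨z, hz⟩ := card_eq_one.1 (show (T \ {x, y}).card = 1 by
      rw [card_sdiff_of_subset hsub, card_pair hxy, hc])
    have hTe : T = {x, y} ∪ {z} := by rw [← hz, union_sdiff_of_subset hsub]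
    have hzm : z ∈ T \ {x, y} := by rw [hz]; simp
    simp only [mem_sdiff, mem_insert, mem_singleton, not_or] at hzm
    obtain ⟨-, hzx, hzy⟩ := hzm
    have aux : ∀ x y : ι, T = {x, y} ∪ {z} → x ≠ y → z ≠ x → z ≠ y → Tr D X {x} →
        ¬ Tr D X {x, y} → δ (symmDiff X {x}) (symmDiff X T) = 0 := by
      intro x y hTe hxy hzx hzy hx hD
      have e : symmDiff X T = symmDiff (symmDiff X {x}) {y, z} := by
        rw [hTe]; ext t
        simp only [mem_symmDiff, mem_union, mem_insert, mem_singleton]; grind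
      rw [e]
      refine h.long le_rfl _ y z (Ne.symm hzy) hx (by rw [← e]; exact hT) ?_
      rintro ⟨h1, -⟩
      apply hD
      unfold Tr
      convert h1 using 1
      ext t
      simp only [mem_symmDiff, mem_insert, mem_singleton]; grind
    have e1 := aux x y hTe hxy hzx hzy hx.1 hD
    have e2 := aux y x (by rw [hTe, pair_comm]) hxy.symm hzy hzx hy.1 (by rwa [pair_comm])
    have e3 : symmDiff X {y} = symmDiff (symmDiff X {x}) {x, y} := by
      ext t; simp only [mem_symmDiff, mem_insert, mem_singleton]; grind
    have e4 : δ (symmDiff X {x}) (symmDiff X {y}) = 0 := by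
      rw [e3]
      refine h.long le_rfl _ x y hxy hx.1 (by rw [← e3]; exact hy.1) ?_
      rintro ⟨-, h1⟩
      apply hD
      unfold Tr
      convert h1 using 1
      ext t
      simp only [mem_symmDiff, mem_insert, mem_singleton]; grind
    have e5 := h.add X (symmDiff X {x}) (symmDiff X {y}) hX hx.1 hy.1 (by
      simp only [symmDiff_symmDiff_cancel_left]
      exact (card_union_le _ _).trans (by simp))
    unfold ff; omega

lemma wd3 (hC : Cochain D d) (h : Good D d 2 δ) {X T : Finset ι} (hX : D X)
    (hT : D (symmDiff X T)) (hc : T.card = 3) : WD D δ X T := by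
  have hl := locC h hX hT hc
  have pairs : ∀ B B', Mid (Tr D X) T B → Mid (Tr D X) T B' → B.card = 2 → B'.card = 2 →
      ff δ X T B = ff δ X T B' := by
    intro B B' hB hB' hb hb'
    have m1 := mid_dual hB
    have m2 := mid_dual hB'
    have f1 := ff_dual h hX hT hc hB
    have f2 := ff_dual h hX hT hc hB'
    obtain ⟨u, hu⟩ := card_eq_one.1 (show (T \ B).card = 1 by
      rw [card_sdiff_of_subset hB.2.2.1, hb, hc])
    obtain ⟨w, hw⟩ := card_eq_one.1 (show (T \ B').card = 1 by
      rw [card_sdiff_of_subset hB'.2.2.1, hb', hc])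
    rw [hu] at m1 f1
    rw [hw] at m2 f2
    by_cases huw : u = w
    · subst huw; omega
    · have := wd3s h hT (by rw [sd_twice]; exact hX) hc huw m1 m2
      omega
  have mixed : ∀ x B, Mid (Tr D X) T {x} → Mid (Tr D X) T B → B.card = 2 →
      ff δ X T {x} = ff δ X T B := by
    intro x B hx hB hb
    by_cases hxB : x ∈ B
    · exact hl _ _ hx hB ⟨x, by simp [hxB]⟩ (by
        rw [union_eq_right.2 (by simpa using hxB)]; exact hB.2.2.2)
    have hxT : x ∈ T := hx.2.2.1 (by simp)
    obtain ⟨y, z, hyz, rfl⟩ := card_eq_two.1 hb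
    have hTe : T = {x, y, z} := by
      symm; apply eq_of_subset_of_card_le
      · have := hB.2.2.1; grind
      · rw [hc, card_insert_of_notMem hxB, card_pair hyz]
    simp only [mem_insert, mem_singleton, not_or] at hxB
    obtain ⟨hxy, hxz⟩ := hxB
    have ms : ∀ y, y ∈ T → Tr D X {y} → Mid (Tr D X) T {y} := fun y hy hD =>
      ⟨hD, by simp, by simpa using hy, card_ne_of_lt (by simp [hc])⟩
    have mp : ∀ x y, x ∈ T → y ∈ T → Tr D X {x, y} → Mid (Tr D X) T {x, y} := fun x y hx hy hD =>
      ⟨hD, by simp, by grind, card_ne_of_lt (lt_of_le_of_lt card_le_two (by simp [hc]))⟩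
    have hyT : y ∈ T := by simp [hTe]
    have hzT : z ∈ T := by simp [hTe]
    by_cases d1 : Tr D X {y}
    · rw [wd3s h hX hT hc hxy hx (ms y hyT d1)]
      exact hl _ _ (ms y hyT d1) hB (by simp) (by
        rw [union_eq_right.2 (by simp)]; exact hB.2.2.2)
    by_cases d2 : Tr D X {z}
    · rw [wd3s h hX hT hc hxz hx (ms z hzT d2)]
      exact hl _ _ (ms z hzT d2) hB ⟨z, by simp⟩ (by
        rw [union_eq_right.2 (by simp)]; exact hB.2.2.2)
    by_cases d3 : Tr D X {x, y}
    · have m := mp x y hxT hyT d3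
      rw [← pairs _ _ m hB (card_pair hxy) hb]
      exact hl _ _ hx m (by simp) (by rw [union_eq_right.2 (by simp)]; exact m.2.2.2)
    by_cases d4 : Tr D X {x, z}
    · have m := mp x z hxT hzT d4
      rw [← pairs _ _ m hB (card_pair hxz) hb]
      exact hl _ _ hx m (by simp) (by rw [union_eq_right.2 (by simp)]; exact m.2.2.2)
    subst hTe
    have r := hC.rect X x y z hxy hxz hyz hX hx.1 hB.1 hT d1 d2 d3 d4
    have e1 : symmDiff X {x, y, z} = symmDiff (symmDiff X {x}) {y, z} := by
      ext t; simp only [mem_symmDiff, mem_insert, mem_singleton]; grind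
    have e2 : δ (symmDiff X {x}) (symmDiff X {x, y, z}) = 0 := by
      rw [e1]
      refine h.long le_rfl _ y z hyz hx.1 (by rw [← e1]; exact hT) ?_
      rintro ⟨h1, -⟩
      apply d3
      unfold Tr
      convert h1 using 1
      ext t; simp only [mem_symmDiff, mem_insert, mem_singleton]; grind
    have e3 : δ X (symmDiff X {y, z}) = 0 :=
      h.long le_rfl _ y z hyz hX hB.1 (fun hh => d1 hh.1)
    have e4 : symmDiff X {x, y, z} = symmDiff (symmDiff X {y, z}) {x} := by
      ext t; simp only [mem_symmDiff, mem_insert, mem_singleton]; grind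
    have e5 := h.short _ x hX hx.1
    have e6 := h.short (symmDiff X {y, z}) x hB.1 (by rw [← e4]; exact hT)
    rw [← e4] at e6
    unfold ff; omega
  intro B B' hB hB'
  have c1 : ∀ B, Mid (Tr D X) T B → B.card = 1 ∨ B.card = 2 := by
    intro B hB
    have b3 := card_lt_card (ssubset_of_subset_of_ne hB.2.2.1 hB.2.2.2)
    have b4 := card_pos.2 hB.2.1
    omega
  rcases c1 B hB with hb | hb <;> rcases c1 B' hB' with hb' | hb'
  · obtain ⟨x, rfl⟩ := card_eq_one.1 hb
    obtain ⟨y, rfl⟩ := card_eq_one.1 hb'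
    by_cases hxy : x = y
    · rw [hxy]
    · exact wd3s h hX hT hc hxy hB hB'
  · obtain ⟨x, rfl⟩ := card_eq_one.1 hb
    exact mixed x B' hB hB' hb'
  · obtain ⟨x, rfl⟩ := card_eq_one.1 hb'
    exact (mixed x B hB' hB hb).symm
  · exact pairs _ _ hB hB' hb hb'

lemma ff2 (h : Good D d 1 δ) {X : Finset ι} {i j : ι} (hij : i ≠ j) (hX : D X)
    (hT : D (symmDiff X {i, j})) (hi : D (symmDiff X {i})) :
    ff δ X {i, j} {i} = d X (symmDiff X {i}) + d (symmDiff X {i}) (symmDiff X {i, j}) := by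
  have e4 : symmDiff X {i, j} = symmDiff (symmDiff X {i}) {j} := by
    ext t; simp only [mem_symmDiff, mem_insert, mem_singleton]; grind
  have e6 := h.short (symmDiff X {i}) j hi (by rw [← e4]; exact hT)
  rw [← e4] at e6
  rw [ff, e6, h.short X i hX hi]

lemma mid2 {X : Finset ι} {i j : ι} {B : Finset ι} (hB : Mid (Tr D X) {i, j} B) :
    B = {i} ∨ B = {j} := by
  obtain ⟨-, h2, h3, h4⟩ := hB
  by_cases hi : i ∈ B <;> by_cases hj : j ∈ B
  · exact absurd (by grind) h4
  · left; ext t; have := @h3 t; simp only [mem_insert, mem_singleton] at *; grind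
  · right; ext t; have := @h3 t; simp only [mem_insert, mem_singleton] at *; grind
  · obtain ⟨t, ht⟩ := h2
    have := @h3 t; simp only [mem_insert, mem_singleton] at *; grind

lemma wd2 (hC : Cochain D d) (h : Good D d 1 δ) {X T : Finset ι} (hX : D X)
    (hT : D (symmDiff X T)) (hc : T.card = 2) : WD D δ X T := by
  obtain ⟨i, j, hij, rfl⟩ := card_eq_two.1 hc
  have key : Mid (Tr D X) {i, j} {i} → Mid (Tr D X) {i, j} {j} →
      ff δ X {i, j} {i} = ff δ X {i, j} {j} := by
    intro h1 h2
    have := ff2 h hij.symm hX (by rw [pair_comm]; exact hT) h2.1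
    rw [pair_comm j i] at this
    rw [ff2 h hij hX hT h1.1, this]
    exact hC.sq X i j hij hX h1.1 h2.1 hT
  intro B B' hB hB'
  rcases mid2 hB with rfl | rfl <;> rcases mid2 hB' with rfl | rfl
  · rfl
  · exact key hB hB'
  · exact (key hB' hB).symm
  · rfl

lemma wd (hC : Cochain D d) (h : Good D d k δ) {X T : Finset ι} (hX : D X)
    (hT : D (symmDiff X T)) (hc : T.card = k + 1) (hk : 1 ≤ k) : WD D δ X T := by
  by_cases h4 : 4 ≤ k
  · exact wd5 hC h hX hT hc h4
  obtain rfl | rfl | rfl : k = 1 ∨ k = 2 ∨ k = 3 := by omega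
  · exact wd2 hC h hX hT hc
  · exact wd3 hC h hX hT hc
  · exact wd4 hC h hX hT hc
end pot

section step
variable {ι : Type*} [DecidableEq ι]
variable {D : Finset ι → Prop} {d δ : Finset ι → Finset ι → ℤ} {k : ℕ}

/-- insertion of an intermediate vertex -/
lemma add_via (h : Good D d k δ) {X Y Z X' : Finset ι} (hX : D X) (hY : D Y) (hZ : D Z)
    (hX' : D X') (c1 : (symmDiff X X' ∪ symmDiff X Y).card ≤ k)
    (c2 : (symmDiff X X' ∪ symmDiff X Z).card ≤ k)
    (c3 : (symmDiff X' Y ∪ symmDiff X' Z).card ≤ k) : δ X Y + δ Y Z = δ X Z := by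
  have a1 := h.add X X' Y hX hX' hY c1
  have a2 := h.add X X' Z hX hX' hZ c2
  have a3 := h.add X' Y Z hX' hY hZ c3
  omega

lemma add_step (hC : Cochain D d) (h : Good D d k δ) {X Y Z : Finset ι} (hX : D X) (hY : D Y)
    (hZ : D Z) (hU : (symmDiff X Y ∪ symmDiff X Z).card ≤ k + 1)
    (cXY : (symmDiff X Y).card ≤ k) {i y1 y2 : ι}
    (hi : i ∈ symmDiff X Y ∩ symmDiff X Z) (h1 : y1 ∈ symmDiff X Y \ symmDiff X Z)
    (h2 : y2 ∈ symmDiff X Y \ symmDiff X Z) (hne : y1 ≠ y2) : δ X Y + δ Y Z = δ X Z := by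
  rw [mem_inter] at hi
  rw [mem_sdiff] at h1 h2
  obtain ⟨j, hj, hD⟩ := hC.exch X Y hX hY i hi.1
  have small : ∀ V : Finset ι, ∀ t, t ∈ symmDiff X Y ∪ symmDiff X Z →
      V ⊆ symmDiff X Y ∪ symmDiff X Z → t ∉ V → V.card ≤ k := by
    intro V t ht hV htV
    have : V ⊆ (symmDiff X Y ∪ symmDiff X Z).erase t := by
      intro x hx
      rw [mem_erase]
      exact ⟨by rintro rfl; exact htV hx, hV hx⟩
    have := card_le_card this
    rw [card_erase_of_mem ht] at this
    omega
  obtain ⟨y, hy, hyj⟩ : ∃ y, (y ∈ symmDiff X Y ∧ y ∉ symmDiff X Z) ∧ y ≠ j := by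
    by_cases h : y1 = j
    · exact ⟨y2, h2, by rw [← h]; exact hne.symm⟩
    · exact ⟨y1, h1, h⟩
  have hyi : y ≠ i := by rintro rfl; exact hy.2 hi.2
  refine add_via h hX hY hZ hD ?_ ?_ ?_
  · refine le_trans (card_le_card ?_) cXY
    rw [symmDiff_symmDiff_cancel_left]
    exact union_subset (by grind) subset_rfl
  · rw [symmDiff_symmDiff_cancel_left]
    refine small _ y (by simp [hy.1]) (union_subset ?_ subset_union_right) ?_
    · intro t ht; simp only [mem_insert, mem_singleton] at ht
      rcases ht with rfl | rfl <;> simp [hi, hj]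
    · simp only [mem_union, mem_insert, mem_singleton]; tauto
  · refine small _ i (by simp [hi.1]) ?_ ?_
    · intro t
      simp only [mem_union, mem_symmDiff, mem_insert, mem_singleton] at *
      grind
    · simp only [mem_union, mem_symmDiff, mem_insert, mem_singleton] at *
      grind

lemma tA {X Y Z : Finset ι} {x : ι} (h1 : x ∈ symmDiff X Y ∪ symmDiff X Z)
    (h2 : x ∉ symmDiff Y Z) : x ∈ symmDiff X Y ∩ symmDiff X Z := by
  simp only [mem_inter, mem_union, mem_symmDiff] at *; tauto

lemma tB {X Y Z : Finset ι} {y : ι} (h : y ∈ symmDiff X Y \ symmDiff X Z) :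
    y ∈ symmDiff Y Z ∩ symmDiff Y X := by
  simp only [mem_inter, mem_sdiff, mem_symmDiff] at *; tauto

lemma tC {X Y Z : Finset ι} {y : ι} (h : y ∈ symmDiff X Z \ symmDiff X Y) :
    y ∈ symmDiff Y Z \ symmDiff Y X := by
  simp only [mem_sdiff, mem_symmDiff] at *; tauto

lemma tD {X Y Z : Finset ι} {y : ι} (h : y ∈ symmDiff X Z \ symmDiff X Y) :
    y ∈ symmDiff Z X ∩ symmDiff Z Y := by
  simp only [mem_inter, mem_sdiff, mem_symmDiff] at *; tauto

lemma tE {X Y Z : Finset ι} {y : ι} (h : y ∈ symmDiff X Y ∩ symmDiff X Z) :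
    y ∈ symmDiff Z X \ symmDiff Z Y := by
  simp only [mem_inter, mem_sdiff, mem_symmDiff] at *; tauto

lemma tF (x y z : ι) : ({x, y} ∪ {x, z} : Finset ι) = {x, y, z} := by
  ext t; simp only [mem_union, mem_insert, mem_singleton]; tauto

lemma tG (X : Finset ι) (x y z : ι) :
    symmDiff (symmDiff X {x}) (symmDiff X {x, y}) ∪ symmDiff (symmDiff X {x}) (symmDiff X {x, z})
      ⊆ {y, z} := by
  intro t
  simp only [mem_union, mem_symmDiff, mem_insert, mem_singleton]; grind

lemma tH (X : Finset ι) {x y z : ι} (h1 : x ≠ y) (h2 : x ≠ z) (h3 : y ≠ z) :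
    symmDiff X {x, z} = symmDiff (symmDiff X {x, y}) {y, z} := by
  ext t
  simp only [mem_symmDiff, mem_insert, mem_singleton]; grind

lemma tI (X : Finset ι) {x y : ι} (h1 : x ≠ y) :
    symmDiff (symmDiff X {x, y}) {y} = symmDiff X {x} := by
  ext t
  simp only [mem_symmDiff, mem_insert, mem_singleton]; grind

lemma add_non (hC : Cochain D d) (h : Good D d k δ) {X Y Z : Finset ι} (hX : D X) (hY : D Y)
    (hZ : D Z) (hU : (symmDiff X Y ∪ symmDiff X Z).card ≤ k + 1)
    (cXY : (symmDiff X Y).card ≤ k) (cXZ : (symmDiff X Z).card ≤ k)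
    (cYZ : (symmDiff Y Z).card ≤ k) : δ X Y + δ Y Z = δ X Z := by
  by_cases hUk : (symmDiff X Y ∪ symmDiff X Z).card ≤ k
  · exact h.add X Y Z hX hY hZ hUk
  have hUe : (symmDiff X Y ∪ symmDiff X Z).card = k + 1 := by omega
  have nXY := h.neg hX hY cXY
  have nXZ := h.neg hX hZ cXZ
  have nYZ := h.neg hY hZ cYZ
  have eU1 : symmDiff Y Z ∪ symmDiff Y X = symmDiff X Y ∪ symmDiff X Z := by
    ext t; simp only [mem_union, mem_symmDiff]; tauto
  have eU2 : symmDiff Z X ∪ symmDiff Z Y = symmDiff X Y ∪ symmDiff X Z := by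
    ext t; simp only [mem_union, mem_symmDiff]; tauto
  have getne : ∀ P : Finset ι, P.card ≤ k → ∃ t ∈ symmDiff X Y ∪ symmDiff X Z, t ∉ P := by
    intro P hP
    by_contra hcon
    push Not at hcon
    have := card_le_card (show symmDiff X Y ∪ symmDiff X Z ⊆ P from hcon)
    omega
  obtain ⟨z, hzU, hz⟩ := getne _ cXY
  obtain ⟨y, hyU, hy⟩ := getne _ cXZ
  obtain ⟨x, hxU, hx⟩ := getne _ cYZ
  have hx' := tA hxU hx
  have hy' : y ∈ symmDiff X Y \ symmDiff X Z := by
    rw [mem_union] at hyU; rw [mem_sdiff]; exact ⟨hyU.resolve_right hy, hy⟩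
  have hz' : z ∈ symmDiff X Z \ symmDiff X Y := by
    rw [mem_union] at hzU; rw [mem_sdiff]; exact ⟨hzU.resolve_left hz, hz⟩
  by_cases b1 : ∃ y', y' ∈ symmDiff X Y \ symmDiff X Z ∧ y' ≠ y
  · obtain ⟨y', hy'', hne⟩ := b1
    exact add_step hC h hX hY hZ hU cXY hx' hy'' hy' hne
  by_cases b2 : ∃ z', z' ∈ symmDiff X Z \ symmDiff X Y ∧ z' ≠ z
  · obtain ⟨z', hz'', hne⟩ := b2
    have := add_step hC h hY hZ hX (by rwa [eU1]) cYZ (tB hy') (tC hz'') (tC hz') hne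
    omega
  by_cases b3 : ∃ x', x' ∈ symmDiff X Y ∩ symmDiff X Z ∧ x' ≠ x
  · obtain ⟨x', hx'', hne⟩ := b3
    have := add_step hC h hZ hX hY (by rwa [eU2]) (by rwa [symmDiff_comm]) (tD hz') (tE hx'')
      (tE hx') hne
    omega
  push Not at b1 b2 b3
  rw [mem_inter] at hx'
  rw [mem_sdiff] at hy' hz'
  have hxy : x ≠ y := by rintro rfl; exact hy hx'.2
  have hxz : x ≠ z := by rintro rfl; exact hz hx'.1
  have hyz : y ≠ z := by rintro rfl; exact hz hy'.1
  have sXY : symmDiff X Y = {x, y} := by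
    ext t
    simp only [mem_insert, mem_singleton]
    constructor
    · intro ht
      by_cases ht' : t ∈ symmDiff X Z
      · left; exact b3 t (mem_inter.2 ⟨ht, ht'⟩)
      · right; exact b1 t (mem_sdiff.2 ⟨ht, ht'⟩)
    · rintro (rfl | rfl)
      · exact hx'.1
      · exact hy'.1
  have sXZ : symmDiff X Z = {x, z} := by
    ext t
    simp only [mem_insert, mem_singleton]
    constructor
    · intro ht
      by_cases ht' : t ∈ symmDiff X Y
      · left; exact b3 t (mem_inter.2 ⟨ht', ht⟩)
      · right; exact b2 t (mem_sdiff.2 ⟨ht, ht'⟩)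
    · rintro (rfl | rfl)
      · exact hx'.2
      · exact hz'.1
  have hY' : Y = symmDiff X {x, y} := by rw [← sXY, symmDiff_symmDiff_cancel_left]
  have hZ' : Z = symmDiff X {x, z} := by rw [← sXZ, symmDiff_symmDiff_cancel_left]
  have hk : k = 2 := by
    have e : symmDiff X Y ∪ symmDiff X Z = {x, y, z} := by
      rw [sXY, sXZ, tF]
    rw [e, card_eq_three.2 ⟨x, y, z, hxy, hxz, hyz, rfl⟩] at hUe
    omega
  have c2 : ∀ p q : ι, ({p, q} : Finset ι).card ≤ k := by
    intro p q; rw [hk]; exact card_le_two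
  by_cases hW : D (symmDiff X {x})
  · refine add_via h hX hY hZ hW ?_ ?_ ?_
    · rw [symmDiff_symmDiff_cancel_left, sXY]
      exact le_trans (card_le_card (by grind)) (c2 x y)
    · rw [symmDiff_symmDiff_cancel_left, sXZ]
      exact le_trans (card_le_card (by grind)) (c2 x z)
    · refine le_trans (card_le_card ?_) (c2 y z)
      rw [hY', hZ']; exact tG X x y z
  · have e1 : δ X Y = 0 := by
      rw [hY']
      exact h.long (by omega) X x y hxy hX (by rw [← hY']; exact hY) (fun hh => hW hh.1)
    have e2 : δ X Z = 0 := by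
      rw [hZ']
      exact h.long (by omega) X x z hxz hX (by rw [← hZ']; exact hZ) (fun hh => hW hh.1)
    have eZ : Z = symmDiff Y {y, z} := by
      rw [hY', hZ']; exact tH X hxy hxz hyz
    have eW : symmDiff Y {y} = symmDiff X {x} := by
      rw [hY']; exact tI X hxy
    have e3 : δ Y Z = 0 := by
      rw [eZ]
      exact h.long (by omega) Y y z hyz hY (by rw [← eZ]; exact hZ) (fun hh => hW (by
        rw [← eW]; exact hh.1))
    omega

open Classical in
/-- extension of `δ` to the next distance -/
noncomputable def exd (D : Finset ι → Prop) (δ : Finset ι → Finset ι → ℤ) (k : ℕ) :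
    Finset ι → Finset ι → ℤ := fun X Z =>
  if (symmDiff X Z).card = k + 1 then
    (if h : ∃ B, Mid (Tr D X) (symmDiff X Z) B then ff δ X (symmDiff X Z) h.choose else 0)
  else δ X Z

lemma ext_small {X Z : Finset ι} (h : (symmDiff X Z).card ≤ k) : exd D δ k X Z = δ X Z := by
  rw [exd, if_neg (by omega)]

lemma ext_mid (hC : Cochain D d) (h : Good D d k δ) (hk : 1 ≤ k) {X Z B : Finset ι} (hX : D X)
    (hZ : D Z) (hc : (symmDiff X Z).card = k + 1) (hB : Mid (Tr D X) (symmDiff X Z) B) :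
    exd D δ k X Z = ff δ X (symmDiff X Z) B := by
  rw [exd, if_pos hc, dif_pos ⟨B, hB⟩]
  exact wd hC h hX (by rwa [symmDiff_symmDiff_cancel_left]) hc hk _ _
    (Exists.choose_spec ⟨B, hB⟩) hB

lemma ext_nomid {X Z : Finset ι} (hc : (symmDiff X Z).card = k + 1)
    (hB : ¬ ∃ B, Mid (Tr D X) (symmDiff X Z) B) :
    exd D δ k X Z = 0 := by
  rw [exd, if_pos hc, dif_neg hB]

lemma ext_neg (hC : Cochain D d) (h : Good D d k δ) (hk : 1 ≤ k) {X Z : Finset ι} (hX : D X)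
    (hZ : D Z) (hc : (symmDiff X Z).card ≤ k + 1) : exd D δ k Z X = - exd D δ k X Z := by
  by_cases hc' : (symmDiff X Z).card ≤ k
  · rw [ext_small hc', ext_small (by rwa [symmDiff_comm]), h.neg hX hZ hc']
  have hc : (symmDiff X Z).card = k + 1 := by omega
  have hcs : (symmDiff Z X).card = k + 1 := by rwa [symmDiff_comm]
  have eZ : symmDiff X (symmDiff X Z) = Z := symmDiff_symmDiff_cancel_left _ _
  have eX : symmDiff Z (symmDiff X Z) = X := by
    rw [symmDiff_comm X Z]; exact symmDiff_symmDiff_cancel_left _ _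
  by_cases hm : ∃ B, Mid (Tr D X) (symmDiff X Z) B
  · obtain ⟨B, hB⟩ := hm
    have hB' := mid_dual hB
    have hf := ff_dual h hX (by rwa [eZ]) hc hB
    rw [eZ] at hB' hf
    rw [ext_mid hC h hk hX hZ hc hB, ext_mid hC h hk hZ hX hcs
      (by rw [symmDiff_comm Z X]; exact hB'), symmDiff_comm Z X, hf]
  · rw [ext_nomid hc hm, ext_nomid hcs, neg_zero]
    rintro ⟨B, hB⟩
    have hB' := mid_dual hB
    rw [symmDiff_comm Z X, eX] at hB'
    exact hm ⟨_, hB'⟩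

lemma ext_anti (hC : Cochain D d) (h : Good D d k δ) (hk : 1 ≤ k) {X Y Z : Finset ι} (hX : D X)
    (hY : D Y) (hZ : D Z) (hc : (symmDiff X Z).card = k + 1) (hs : symmDiff X Y ⊆ symmDiff X Z) :
    exd D δ k X Y + exd D δ k Y Z = exd D δ k X Z := by
  have hself : ∀ W, D W → exd D δ k W W = 0 := fun W hW => by
    rw [ext_small (by simp), h.self hW]
  by_cases hXY : X = Y
  · subst hXY; rw [hself X hX, zero_add]
  by_cases hYZ : Y = Z
  · subst hYZ; rw [hself Y hY, add_zero]
  have eY : symmDiff X (symmDiff X Y) = Y := symmDiff_symmDiff_cancel_left _ _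
  have eZ : symmDiff X (symmDiff X Z) = Z := symmDiff_symmDiff_cancel_left _ _
  have hne : symmDiff X Y ≠ symmDiff X Z := by
    intro he; apply hYZ; rw [← eY, he, eZ]
  have hnon : (symmDiff X Y).Nonempty := by
    rw [nonempty_iff_ne_empty]; intro he; apply hXY
    rw [← eY, he]; ext t; simp [mem_symmDiff]
  have hB : Mid (Tr D X) (symmDiff X Z) (symmDiff X Y) := ⟨by
    rw [Tr, eY]; exact hY, hnon, hs, hne⟩
  have c1 : (symmDiff X Y).card ≤ k := by
    have := card_lt_card (ssubset_of_subset_of_ne hs hne); omega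
  have c2 : (symmDiff Y Z).card ≤ k := by
    have := card_lt_card (sdiff_ssubset hs hnon)
    have e : symmDiff Y Z = symmDiff X Z \ symmDiff X Y := by
      ext t; have := @hs t; simp only [mem_symmDiff, mem_sdiff] at *; tauto
    rw [e]; omega
  rw [ext_mid hC h hk hX hZ hc hB, ff, eY, eZ, ext_small c1, ext_small c2]

lemma good_step (hC : Cochain D d) (h : Good D d k δ) (hk : 1 ≤ k) :
    Good D d (k + 1) (exd D δ k) := by
  refine ⟨?_, ?_, ?_⟩
  · intro X Y Z hX hY hZ hU
    have cXY := (card_le_card (subset_union_left : symmDiff X Y ⊆ symmDiff X Y ∪ symmDiff X Z)).trans hU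
    have cXZ := (card_le_card (subset_union_right : symmDiff X Z ⊆ symmDiff X Y ∪ symmDiff X Z)).trans hU
    have sYZ : symmDiff Y Z ⊆ symmDiff X Y ∪ symmDiff X Z := by
      intro t; simp only [mem_union, mem_symmDiff]; tauto
    have cYZ := (card_le_card sYZ).trans hU
    by_cases a1 : (symmDiff X Z).card = k + 1
    · refine ext_anti hC h hk hX hY hZ a1 ?_
      rw [eq_of_subset_of_card_le (subset_union_right : symmDiff X Z ⊆ symmDiff X Y ∪ symmDiff X Z)
        (by omega)]
      exact subset_union_left
    by_cases a2 : (symmDiff X Y).card = k + 1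
    · have := ext_anti hC h hk hX hZ hY a2 (by
        rw [eq_of_subset_of_card_le (subset_union_left : symmDiff X Y ⊆ symmDiff X Y ∪ symmDiff X Z)
          (by omega)]
        exact subset_union_right)
      have n := ext_neg hC h hk hY hZ cYZ
      omega
    by_cases a3 : (symmDiff Y Z).card = k + 1
    · have := ext_anti hC h hk hY hX hZ a3 (by
        rw [eq_of_subset_of_card_le sYZ (by omega), symmDiff_comm]
        exact subset_union_left)
      have n := ext_neg hC h hk hX hY cXY
      omega
    rw [ext_small (by omega), ext_small (by omega), ext_small (by omega)]
    exact add_non hC h hX hY hZ hU (by omega) (by omega) (by omega)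
  · intro X i hX hi
    rw [ext_small (by rw [symmDiff_symmDiff_cancel_left]; simpa using hk)]
    exact h.short X i hX hi
  · intro _ X i j hij hX hT hn
    have e := symmDiff_symmDiff_cancel_left X ({i, j} : Finset ι)
    by_cases hk2 : 2 ≤ k
    · rw [ext_small (by rw [e]; exact card_le_two.trans hk2)]
      exact h.long hk2 X i j hij hX hT hn
    have hk1 : k = 1 := by omega
    subst hk1
    have hc : (symmDiff X (symmDiff X {i, j})).card = 1 + 1 := by rw [e, card_pair hij]
    by_cases hm : ∃ B, Mid (Tr D X) (symmDiff X (symmDiff X {i, j})) B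
    · obtain ⟨B, hB⟩ := hm
      rw [ext_mid hC h hk hX hT hc hB]
      rw [e] at hB ⊢
      rcases mid2 hB with rfl | rfl
      · have hi : D (symmDiff X {i}) := hB.1
        rw [ff2 h hij hX hT hi]
        exact hC.tri X i j hij hX hi (fun hj => hn ⟨hi, hj⟩) hT
      · have hj := hB.1
        rw [pair_comm] at hT ⊢
        rw [ff2 h hij.symm hX hT hB.1]
        exact hC.tri X _ i hij.symm hX hB.1 (fun hi => hn ⟨hi, hj⟩) hT
    · exact ext_nomid hc hm

lemma good_base (hC : Cochain D d) : Good D d 1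
    (fun X Y => if (symmDiff X Y).card = 1 then d X Y else 0) := by
  refine ⟨?_, ?_, fun h => absurd h (by norm_num)⟩
  · intro X Y Z hX hY hZ hc
    have key : ∀ X Y, D X → D Y → (symmDiff X Y).card = 1 → d Y X = - d X Y := by
      intro X Y hX hY h1
      obtain ⟨i, hi⟩ := card_eq_one.1 h1
      have e : Y = symmDiff X {i} := by rw [← hi, symmDiff_symmDiff_cancel_left]
      rw [e]; exact hC.anti X i hX (by rwa [← e])
    have e0 : ∀ X : Finset ι, symmDiff X X = ∅ := fun X => by simp
    by_cases h1 : X = Y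
    · subst h1; simp
    by_cases h2 : Y = Z
    · subst h2; simp
    have h3 : X = Z := by
      have aux : ∀ W, X ≠ W → symmDiff X W ⊆ symmDiff X Y ∪ symmDiff X Z →
          symmDiff X W = symmDiff X Y ∪ symmDiff X Z := by
        intro W hW hs
        apply eq_of_subset_of_card_le hs
        have : (symmDiff X W).Nonempty := by
          rw [nonempty_iff_ne_empty]; intro he; apply hW
          rw [← symmDiff_symmDiff_cancel_left X W, he]; ext t; simp [mem_symmDiff]
        have := card_pos.2 this
        omega
      by_contra h3
      apply h2
      have e := (aux Y h1 subset_union_left).trans (aux Z h3 subset_union_right).symm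
      have := congrArg (symmDiff X) e
      simpa only [symmDiff_symmDiff_cancel_left] using this
    subst h3
    simp only [symmDiff_comm Y X, e0]
    by_cases hc1 : (symmDiff X Y).card = 1
    · simp [hc1, key X Y hX hY hc1]
    · simp [hc1]
  · intro X i hX hi
    simp

theorem potential (hC : Cochain D d) (k : ℕ) : ∃ δ, Good D d (k + 1) δ := by
  induction k with
  | zero => exact ⟨_, good_base hC⟩
  | succ k ih => obtain ⟨δ, h⟩ := ih; exact ⟨_, good_step hC h (by omega)⟩
end step

section trans
variable {n : ℕ}

/-- transversal of a set of coordinates -/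
def toA (X : Finset (Fin n)) : Finset (JJ n) := univ.filter fun x => (x.2 = true ↔ x.1 ∈ X)

/-- coordinates of a transversal -/
def fromA (A : Finset (JJ n)) : Finset (Fin n) := univ.filter fun i => (i, true) ∈ A

lemma mem_toA {X : Finset (Fin n)} {x : JJ n} : x ∈ toA X ↔ (x.2 = true ↔ x.1 ∈ X) := by
  simp [toA]

lemma card_toA_filter (X : Finset (Fin n)) (P : JJ n → Prop) [DecidablePred P] :
    ((toA X).filter P).card = (univ.filter fun c => P (c, decide (c ∈ X))).card := by
  have : (toA X).filter P =
      (univ.filter fun c => P (c, decide (c ∈ X))).image (fun c => (c, decide (c ∈ X))) := by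
    ext ⟨c, b⟩
    simp only [mem_filter, mem_toA, mem_image, mem_univ, true_and, Prod.mk.injEq]
    constructor
    · rintro ⟨h1, h2⟩
      have hb : decide (c ∈ X) = b := by
        by_cases hc : c ∈ X <;> simp_all
      exact ⟨c, by rwa [hb], rfl, hb⟩
    · rintro ⟨c', h1, rfl, rfl⟩
      exact ⟨by simp, h1⟩
  rw [this, card_image_of_injective]
  intro a b h
  exact (Prod.mk.inj h).1

lemma card_toA (X : Finset (Fin n)) : (toA X).card = n := by
  have := card_toA_filter X (fun _ => True)
  simpa using this

lemma toA_fromA {A : Finset (JJ n)} (h : AdmissibleSet A) (hc : A.card = n) :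
    toA (fromA A) = A := by
  symm
  apply eq_of_subset_of_card_le
  · rintro ⟨c, b⟩ hx
    rw [mem_toA]
    simp only [fromA, mem_filter, mem_univ, true_and]
    cases b
    · have := h _ hx
      simpa [starJ] using this
    · simpa using hx
  · rw [card_toA, hc]

lemma toA_inj {X Y : Finset (Fin n)} (h : toA X = toA Y) : X = Y := by
  ext c
  have : (c, true) ∈ toA X ↔ (c, true) ∈ toA Y := by rw [h]
  simpa [mem_toA] using this

lemma height_toA (F X : Finset (Fin n)) : heightF (toA F) (toA X) = (symmDiff F X).card := by
  have h1 : toA X ∩ toA F = (toA X).filter (fun x => x ∈ toA F) := by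
    ext x; simp
  rw [heightF, h1, card_toA_filter]
  have h2 : (univ.filter fun c => (c, decide (c ∈ X)) ∈ toA F) = (symmDiff F X)ᶜ := by
    ext c; simp only [mem_filter, mem_univ, true_and, mem_toA, mem_compl, mem_symmDiff,
      decide_eq_true_eq]; tauto
  rw [h2, card_compl, Fintype.card_fin]
  have := card_le_univ (symmDiff F X)
  rw [Fintype.card_fin] at this
  omega

lemma expo_toA (G H A : Finset (Fin n)) :
    (toA G \ (toA H ∪ toA A)).card = (symmDiff G H ∩ symmDiff G A).card := by
  have h1 : toA G \ (toA H ∪ toA A) = (toA G).filter (fun x => x ∉ toA H ∪ toA A) := by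
    ext x; simp
  rw [h1, card_toA_filter]
  congr 1
  ext c; simp only [mem_filter, mem_univ, true_and, mem_toA, mem_union, mem_inter, mem_symmDiff,
      decide_eq_true_eq]; tauto

lemma symmDiff_toA {X Y : Finset (Fin n)} {x : JJ n} :
    x ∈ symmDiff (toA X) (toA Y) ↔ x.1 ∈ symmDiff X Y := by
  simp only [mem_symmDiff, mem_toA]; tauto

/-- sign vector -/
def eps (X : Finset (Fin n)) (c : Fin n) : ℝ := if c ∈ X then -1 else 1

lemma eSet_toA (X : Finset (Fin n)) : eSet (toA X) = eps X := by
  funext c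
  simp only [eSet, Finset.sum_apply, eVec]
  rw [Finset.sum_eq_single (c, decide (c ∈ X))]
  · simp [eps]
  · rintro ⟨c', b⟩ hb hne
    rw [if_neg]
    rintro rfl
    apply hne
    rw [mem_toA] at hb
    by_cases h : c ∈ X <;> simp_all
  · intro h
    exact absurd (by simp [mem_toA]) h

/-- increments of a functional -/
noncomputable def inc (L : (Fin n → ℝ) →ₗ[ℝ] ℝ) (X : Finset (Fin n)) (c : Fin n) : ℝ :=
  -2 * L (Pi.single c 1) * eps X c

lemma L_diff (L : (Fin n → ℝ) →ₗ[ℝ] ℝ) (X S : Finset (Fin n)) :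
    L (eSet (toA (symmDiff X S))) = L (eSet (toA X)) + ∑ c ∈ S, inc L X c := by
  rw [eSet_toA, eSet_toA, LinearMap.pi_apply_eq_sum_univ L, LinearMap.pi_apply_eq_sum_univ L (eps X)]
  rw [← Finset.sum_filter_add_sum_filter_not univ (fun c => c ∈ S)]
  rw [← Finset.sum_filter_add_sum_filter_not univ (fun c => c ∈ S) (fun i => eps X i • _)]
  have e1 : univ.filter (fun c => c ∈ S) = S := by ext; simp
  rw [e1]
  have hs : ∀ c : Fin n, (fun j => if c = j then (1:ℝ) else 0) = Pi.single c 1 := by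
    intro c; funext j; simp [Pi.single_apply, eq_comm]
  have h2 : ∑ x with x ∉ S, eps (symmDiff X S) x • L (fun j => if x = j then (1:ℝ) else 0)
      = ∑ x with x ∉ S, eps X x • L (fun j => if x = j then (1:ℝ) else 0) := by
    apply Finset.sum_congr rfl
    intro c hc
    have hc : c ∉ S := by simpa using hc
    simp [eps, mem_symmDiff, hc]
  rw [h2]
  have h1 : ∑ x ∈ S, eps (symmDiff X S) x • L (fun j => if x = j then (1:ℝ) else 0)
      = ∑ x ∈ S, eps X x • L (fun j => if x = j then (1:ℝ) else 0) + ∑ c ∈ S, inc L X c := by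
    rw [← Finset.sum_add_distrib]
    apply Finset.sum_congr rfl
    intro c hc
    have : eps (symmDiff X S) c = - eps X c := by
      simp only [eps, mem_symmDiff, hc]
      by_cases h : c ∈ X <;> simp [h]
    rw [this, hs, inc]; simp only [smul_eq_mul]; ring
  rw [h1]; ring

/-- the delta-matroid -/
def DD (ℬ : Finset (Finset (JJ n))) (X : Finset (Fin n)) : Prop := toA X ∈ ℬ

lemma lag_from {ℬ : Finset (Finset (JJ n))} (hM : IsLagrangianMatroid ℬ) {A} (hA : A ∈ ℬ) :
    ∃ X, DD ℬ X ∧ toA X = A := by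
  have := toA_fromA (hM.1 A hA).1 (hM.1 A hA).2
  exact ⟨fromA A, by rw [DD, this]; exact hA, this⟩

lemma exists_perm_s5 (S : Finset (Fin n)) (hS : S.Nonempty) :
    ∃ (σ : Equiv.Perm (Fin n)) (a : Fin n), ∀ c, a ≤ σ c ↔ c ∈ S := by
  have hpos := card_pos.2 hS
  have hle := card_le_univ S
  rw [Fintype.card_fin] at hle
  let a : Fin n := ⟨n - S.card, by omega⟩
  have hcard : Fintype.card {c // c ∈ S} = Fintype.card {c : Fin n // a ≤ c} := by
    rw [Fintype.card_coe, Fintype.card_subtype]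
    have : (univ.filter fun c : Fin n => a ≤ c) = Finset.Ici a := by ext; simp
    rw [this, Fin.card_Ici]
    simp only [a]; omega
  let e := Fintype.equivOfCardEq hcard
  refine ⟨e.extendSubtype, a, fun c => ⟨fun h => ?_, fun h => ?_⟩⟩
  · by_contra hc
    exact e.extendSubtype_not_mem c hc h
  · exact e.extendSubtype_mem c h

lemma count_le {w : Equiv.Perm (JJ n)} {A B : Finset (JJ n)} (h : setLE w B A) (t : ℤ) :
    (B.filter fun x => t ≤ ordJ (w.symm x)).card ≤ (A.filter fun x => t ≤ ordJ (w.symm x)).card := by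
  obtain ⟨f, hf, hle⟩ := h
  apply card_le_card_of_injOn f
  · intro x hx
    simp only [coe_filter, Set.mem_ofPred_eq] at hx ⊢
    exact ⟨hf.mapsTo hx.1, hx.2.trans (hle x hx.1)⟩
  · intro x hx y hy hxy
    simp only [coe_filter, Set.mem_ofPred_eq] at hx hy
    exact hf.injOn hx.1 hy.1 hxy

/-- the admissible permutation attached to an order and a transversal -/
def mkPerm (σ : Equiv.Perm (Fin n)) (P : Finset (Fin n)) : Equiv.Perm (JJ n) where
  toFun x := (σ x.1, xor x.2 (decide (x.1 ∈ P)))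
  invFun x := (σ.symm x.1, xor x.2 (decide (σ.symm x.1 ∈ P)))
  left_inv x := by ext <;> simp
  right_inv x := by ext <;> simp

lemma mkPerm_adm (σ : Equiv.Perm (Fin n)) (P : Finset (Fin n)) :
    AdmissiblePerm (mkPerm σ P).symm := by
  rintro ⟨c, b⟩
  simp [mkPerm, starJ]

lemma exch_lag {ℬ : Finset (Finset (JJ n))} (hM : IsLagrangianMatroid ℬ) : Exch (DD ℬ) := by
  intro X Y hX hY i hi
  set S : Finset (Fin n) := insert i (symmDiff X Y)ᶜ with hS
  set P := symmDiff X {i} with hP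
  obtain ⟨σ, a, hσ⟩ := exists_perm_s5 S ⟨i, by simp [hS]⟩
  obtain ⟨M, hMB, hmax⟩ := hM.2 _ (mkPerm_adm σ P)
  obtain ⟨Z, hZ, rfl⟩ := lag_from hM hMB
  have cnt : ∀ (t : ℕ) (C : Finset (Fin n)),
      ((toA C).filter fun x => ((t : ℤ) + 1) ≤ ordJ ((mkPerm σ P).symm.symm x)).card =
      (univ.filter fun c => (c ∉ symmDiff C P) ∧ t ≤ (σ c : ℕ)).card := by
    intro t C
    rw [card_toA_filter]
    congr 1
    ext c
    simp only [mem_filter, mem_univ, true_and, Equiv.symm_symm, mkPerm, Equiv.coe_fn_mk, ordJ,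
      mem_symmDiff]
    by_cases h1 : c ∈ C <;> by_cases h2 : c ∈ P <;> simp [h1, h2] <;> omega
  have hle : ∀ (t : ℕ) C, DD ℬ C → (univ.filter fun c => (c ∉ symmDiff C P) ∧ t ≤ (σ c : ℕ)).card ≤
      (univ.filter fun c => (c ∉ symmDiff Z P) ∧ t ≤ (σ c : ℕ)).card := by
    intro t C hC
    rw [← cnt, ← cnt]
    exact count_le (hmax _ hC) _
  have hZS : ∀ c ∈ S, c ∉ symmDiff Z P := by
    have h1 := hle a Y hY
    have e1 : (univ.filter fun c => (c ∉ symmDiff Y P) ∧ (a : ℕ) ≤ (σ c : ℕ)) = S := by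
      ext c
      have := hσ c
      rw [Fin.le_def] at this
      simp only [mem_filter, mem_univ, true_and, this]
      refine ⟨fun h => h.2, fun h => ⟨?_, h⟩⟩
      rw [hS, mem_insert, mem_compl] at h
      simp only [hP, mem_symmDiff, mem_singleton] at *
      rcases h with rfl | h
      · tauto
      · by_cases hci : c = i
        · subst hci; tauto
        · tauto
    have e2 : (univ.filter fun c => (c ∉ symmDiff Z P) ∧ (a : ℕ) ≤ (σ c : ℕ)) ⊆ S := by
      intro c
      have := hσ c
      rw [Fin.le_def] at this
      simp only [mem_filter, mem_univ, true_and, this]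
      exact fun h => h.2
    rw [e1] at h1
    have e3 := eq_of_subset_of_card_le e2 h1
    intro c hc
    rw [← e3] at hc
    exact (mem_filter.1 hc).2.1
  have hZ1 : (symmDiff Z P).card ≤ 1 := by
    have h1 := hle 0 X hX
    have e : ∀ C : Finset (Fin n), (univ.filter fun c => (c ∉ symmDiff C P) ∧ 0 ≤ (σ c : ℕ)) =
        (symmDiff C P)ᶜ := by
      intro C; ext c
      simp only [mem_filter, mem_univ, true_and, mem_compl, Nat.zero_le, and_true]
    rw [e, e, card_compl, card_compl, hP, symmDiff_symmDiff_cancel_left, card_singleton] at h1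
    have := card_le_univ (symmDiff Z P)
    have h3 : 0 < Fintype.card (Fin n) := Fintype.card_pos_iff.2 ⟨i⟩
    rw [← hP] at h1
    omega
  have hZe : Z = symmDiff P (symmDiff Z P) := by
    ext c; simp only [mem_symmDiff]; tauto
  rcases Nat.le_one_iff_eq_zero_or_eq_one.1 hZ1 with h0 | h1
  · refine ⟨i, hi, ?_⟩
    rw [card_eq_zero] at h0
    rw [h0] at hZe
    have : symmDiff X {i, i} = Z := by
      rw [hZe, hP]; ext c; simp [mem_symmDiff]
    rw [this]; exact hZ
  · obtain ⟨j, hj⟩ := card_eq_one.1 h1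
    have hjS : j ∉ S := by
      intro h; apply hZS j h; rw [hj]; simp
    rw [hS, mem_insert, mem_compl] at hjS
    push Not at hjS
    refine ⟨j, hjS.2, ?_⟩
    have : symmDiff X {i, j} = Z := by
      rw [hZe, hj, hP]; ext c
      have := hjS.1
      simp only [mem_symmDiff, mem_insert, mem_singleton]; grind
    rw [this]; exact hZ

lemma sd_pair {X Y P : Finset (Fin n)} (h : P ⊆ symmDiff X Y) :
    symmDiff Y P = symmDiff X (symmDiff X Y \ P) := by
  ext c
  have := @h c
  simp only [mem_symmDiff, mem_sdiff] at *; tauto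

lemma edge_cases {ℬ : Finset (Finset (JJ n))} (hM : IsLagrangianMatroid ℬ)
    {X Y : Finset (Fin n)} (h : IsEdge ℬ (toA X) (toA Y)) :
    (∃ i, Y = symmDiff X {i}) ∨
    ∃ i j, i ≠ j ∧ Y = symmDiff X {i, j} ∧ ¬ (DD ℬ (symmDiff X {i}) ∧ DD ℬ (symmDiff X {j})) := by
  obtain ⟨hX, hY, hne, L, hL, hlt⟩ := h
  have hXY : X ≠ Y := by rintro rfl; exact hne rfl
  have eY : symmDiff X (symmDiff X Y) = Y := symmDiff_symmDiff_cancel_left _ _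
  set T := symmDiff X Y with hT
  set g := inc L X with hg
  have hsum : ∑ c ∈ T, g c = 0 := by
    have := L_diff L X T
    rw [eY] at this
    linarith
  have hneg : ∀ S, DD ℬ (symmDiff X S) → S.Nonempty → S ≠ T → ∑ c ∈ S, g c < 0 := by
    intro S hS h1 h2
    have h3 := hlt _ hS (by
      intro h; have h := toA_inj h
      have : S = symmDiff X (symmDiff X S) := (symmDiff_symmDiff_cancel_left _ _).symm
      rw [h] at this; simp at this; simp [this] at h1) (by
      intro h; have h := toA_inj h
      apply h2; rw [hT, ← h, symmDiff_symmDiff_cancel_left])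
    rw [L_diff] at h3
    linarith
  have hTne : T.Nonempty := by
    rw [nonempty_iff_ne_empty]; intro h
    apply hXY; rw [← eY, h]; ext c; simp [mem_symmDiff]
  by_cases h3 : 3 ≤ T.card
  · exfalso
    have hEx := exch_lag hM
    have two : ∀ i j : Fin n, ({i, j} : Finset (Fin n)) ≠ T :=
      fun i j => card_ne_of_lt (lt_of_le_of_lt card_le_two h3)
    obtain ⟨i, hi, himax⟩ := exists_max_image T g hTne
    obtain ⟨i', hi', himin⟩ := exists_min_image T g hTne
    obtain ⟨j, hj, hD⟩ := hEx X Y hX hY i hi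
    obtain ⟨j', hj', hD'⟩ := hEx Y X hY hX i' (by rw [symmDiff_comm]; exact hi')
    rw [symmDiff_comm] at hj'
    have b1 := hneg _ hD (by simp) (two i j)
    have hsub : ({i', j'} : Finset (Fin n)) ⊆ T := by
      intro c hc; simp only [mem_insert, mem_singleton] at hc
      rcases hc with rfl | rfl
      · exact hi'
      · exact hj'
    have e : symmDiff Y {i', j'} = symmDiff X (T \ {i', j'}) :=
      sd_pair hsub
    rw [e] at hD'
    have b2 := hneg _ hD' (by
      rw [sdiff_nonempty]; intro h
      exact two i' j' (subset_antisymm hsub h)) (by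
      exact (sdiff_ssubset hsub (by simp)).ne)
    rw [← Finset.sum_sdiff hsub] at hsum
    have c1 : g i + g i' < 0 ∨ g i < 0 := by
      by_cases hij : i = j
      · subst hij; right; simpa using b1
      · left; rw [sum_pair hij] at b1
        have := himin j hj; linarith
    have b3 : 0 < ∑ c ∈ {i', j'}, g c := by linarith
    have c2 : 0 < g i + g i' ∨ 0 < g i' := by
      by_cases hij : i' = j'
      · subst hij; right; simpa using b3
      · left; rw [sum_pair hij] at b3
        have := himax j' hj'; linarith
    have := himax i' hi'
    rcases c1 with c1 | c1 <;> rcases c2 with c2 | c2 <;> linarith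
  · have := card_pos.2 hTne
    have h12 : T.card = 1 ∨ T.card = 2 := by omega
    rcases h12 with h1 | h2
    · obtain ⟨i, hi⟩ := card_eq_one.1 h1
      left; exact ⟨i, by rw [← hi, eY]⟩
    · obtain ⟨i, j, hij, hTe⟩ := card_eq_two.1 h2
      right
      refine ⟨i, j, hij, by rw [← hTe, eY], ?_⟩
      rintro ⟨d1, d2⟩
      have b1 := hneg _ d1 (by simp) (card_ne_of_lt (by simp [h2]))
      have b2 := hneg _ d2 (by simp) (card_ne_of_lt (by simp [h2]))
      rw [hTe, sum_pair hij] at hsum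
      simp only [sum_singleton] at b1 b2
      linarith

lemma long_edge_aux {ℬ : Finset (Finset (JJ n))} (hM : IsLagrangianMatroid ℬ)
    {X : Finset (Fin n)} {i j : Fin n} (hij : i ≠ j) (hX : DD ℬ X) (hY : DD ℬ (symmDiff X {i, j}))
    (hn : ¬ DD ℬ (symmDiff X {i})) : IsEdge ℬ (toA X) (toA (symmDiff X {i, j})) := by
  refine ⟨hX, hY, ?_, ?_⟩
  · intro h
    have h := toA_inj h
    have : i ∈ X ↔ i ∈ symmDiff X {i, j} := by rw [← h]
    simp [mem_symmDiff] at this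
  let g : Fin n → ℝ := fun c => if c = i then 1 else if c = j then -1 else -2
  let L : (Fin n → ℝ) →ₗ[ℝ] ℝ := ∑ c, (-(eps X c * g c) / 2) • LinearMap.proj c
  have hg : ∀ c, inc L X c = g c := by
    intro c
    have h1 : L (Pi.single c 1) = -(eps X c * g c) / 2 := by
      simp only [L, LinearMap.sum_apply, LinearMap.smul_apply, LinearMap.proj_apply]
      rw [Finset.sum_eq_single c]
      · simp
      · intro b _ hb; simp [Pi.single_apply, hb]
      · simp
    have h2 : eps X c * eps X c = 1 := by unfold eps; split_ifs <;> norm_num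
    rw [inc, h1]
    linear_combination g c * h2
  have gi : g i = 1 := by simp [g]
  have gj : g j = -1 := by simp [g, hij.symm]
  refine ⟨L, ?_, ?_⟩
  · rw [L_diff, sum_pair hij, hg, hg, gi, gj]; ring
  · intro C hC h1 h2
    obtain ⟨Z, hZ, rfl⟩ := lag_from hM hC
    have eZ : symmDiff X (symmDiff X Z) = Z := symmDiff_symmDiff_cancel_left _ _
    set S := symmDiff X Z with hS
    have s0 : S ≠ ∅ := by
      intro h; apply h1; rw [← eZ, h]; congr 1; ext c; simp [mem_symmDiff]
    have s1 : S ≠ {i} := by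
      intro h; apply hn; rw [← h, eZ]; exact hZ
    have s2 : S ≠ {i, j} := by
      intro h; apply h2; rw [← h, eZ]
    rw [← eZ, L_diff]
    simp only [hg]
    suffices hh : ∑ c ∈ S, g c < 0 by linarith
    have gle : ∀ c, c ≠ i → g c ≤ -1 := by
      intro c hc; simp only [g, if_neg hc]; split_ifs <;> norm_num
    by_cases hi : i ∈ S
    · rw [← Finset.add_sum_erase S g hi, gi]
      by_cases ho : ∃ o ∈ S, o ≠ i ∧ o ≠ j
      · obtain ⟨o, hoS, hoi, hoj⟩ := ho
        have hoe : o ∈ S.erase i := mem_erase.2 ⟨hoi, hoS⟩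
        rw [← Finset.add_sum_erase _ g hoe]
        have go : g o = -2 := by simp [g, hoi, hoj]
        have : ∑ x ∈ (S.erase i).erase o, g x ≤ 0 := by
          apply Finset.sum_nonpos
          intro c hc
          have := gle c (by simp only [mem_erase] at hc; exact hc.2.1)
          linarith
        linarith
      · exfalso
        push Not at ho
        by_cases hj : j ∈ S
        · apply s2; ext c; simp only [mem_insert, mem_singleton]; grind
        · apply s1; ext c; simp only [mem_singleton]; grind
    · apply Finset.sum_neg
      · intro c hc
        have := gle c (by rintro rfl; exact hi hc)
        linarith
      · exact nonempty_iff_ne_empty.2 s0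

lemma long_edge {ℬ : Finset (Finset (JJ n))} (hM : IsLagrangianMatroid ℬ)
    {X : Finset (Fin n)} {i j : Fin n} (hij : i ≠ j) (hX : DD ℬ X) (hY : DD ℬ (symmDiff X {i, j}))
    (hn : ¬ (DD ℬ (symmDiff X {i}) ∧ DD ℬ (symmDiff X {j}))) :
    IsLongEdge ℬ (toA X) (toA (symmDiff X {i, j})) := by
  refine ⟨?_, (i, true), (j, true), by simpa using hij, by simp [starJ], ?_⟩
  · by_cases hi : DD ℬ (symmDiff X {i})
    · rw [pair_comm] at hY ⊢
      exact long_edge_aux hM hij.symm hX hY (fun hj => hn ⟨hi, hj⟩)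
    · exact long_edge_aux hM hij hX hY hi
  · ext ⟨c, b⟩
    rw [symmDiff_toA, symmDiff_symmDiff_cancel_left]
    simp only [mem_insert, mem_singleton, starJ, Prod.mk.injEq]
    cases b <;> simp
end trans

section fin
variable {n : ℕ} {ℬ : Finset (Finset (JJ n))} {s : Finset (JJ n) → Finset (JJ n) → ℤ}

/-- signs in coordinates -/
def sg (s : Finset (JJ n) → Finset (JJ n) → ℤ) (X Y : Finset (Fin n)) : ℤ := s (toA X) (toA Y)

lemma sg_val (hs : IsOrientation ℬ s) {X Y : Finset (Fin n)} (hX : DD ℬ X) (hY : DD ℬ Y) :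
    sg s X Y = 1 ∨ sg s X Y = -1 := (hs.2.1 _ hX).1 _ hY

lemma sg_self (hs : IsOrientation ℬ s) {X : Finset (Fin n)} (hX : DD ℬ X) : sg s X X = 1 :=
  (hs.2.1 _ hX).2.2.2.2

lemma sg_change (hs : IsOrientation ℬ s) {G H A : Finset (Fin n)} (hG : DD ℬ G) (hH : DD ℬ H)
    (hA : DD ℬ A) :
    sg s G A = sg s H A * sg s H G * (-1) ^ (symmDiff G H ∩ symmDiff G A).card := by
  have := hs.2.2 _ hG _ hH _ hA
  rw [expo_toA] at this
  exact this

lemma sg_mono (hs : IsOrientation ℬ s) {X S S' : Finset (Fin n)} (hX : DD ℬ X)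
    (h : S ⊆ S') (hS : DD ℬ (symmDiff X S)) (hS' : DD ℬ (symmDiff X S')) :
    sg s (symmDiff X S) (symmDiff X S') = sg s X (symmDiff X S') * sg s X (symmDiff X S) := by
  rw [sg_change hs hS hX hS']
  have : symmDiff (symmDiff X S) X ∩ symmDiff (symmDiff X S) (symmDiff X S') = ∅ := by
    ext c
    have := @h c
    simp only [mem_inter, mem_symmDiff, notMem_empty, iff_false]; tauto
  rw [this]; simp

lemma height_sd (X S : Finset (Fin n)) : heightF (toA X) (toA (symmDiff X S)) = S.card := by
  rw [height_toA, symmDiff_symmDiff_cancel_left]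

lemma sg_long_ne (hM : IsLagrangianMatroid ℬ) (hs : IsOrientation ℬ s) {F X : Finset (Fin n)}
    {i j : Fin n} (hij : i ≠ j) (hF : DD ℬ F) (hX : DD ℬ X) (hY : DD ℬ (symmDiff X {i, j}))
    (hn : ¬ (DD ℬ (symmDiff X {i}) ∧ DD ℬ (symmDiff X {j})))
    (hh : (symmDiff F X).card ≠ (symmDiff F (symmDiff X {i, j})).card) :
    sg s F X = - sg s F (symmDiff X {i, j}) :=
  (hs.2.1 _ hF).2.2.1 _ _ (long_edge hM hij hX hY hn) (by rwa [height_toA, height_toA])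

lemma sg_long_eq (hM : IsLagrangianMatroid ℬ) (hs : IsOrientation ℬ s) {F X : Finset (Fin n)}
    {i j : Fin n} (hij : i ≠ j) (hF : DD ℬ F) (hX : DD ℬ X) (hY : DD ℬ (symmDiff X {i, j}))
    (hn : ¬ (DD ℬ (symmDiff X {i}) ∧ DD ℬ (symmDiff X {j})))
    (hh : (symmDiff F X).card = (symmDiff F (symmDiff X {i, j})).card) :
    sg s F X = sg s F (symmDiff X {i, j}) :=
  (hs.2.1 _ hF).2.1 _ _ (long_edge hM hij hX hY hn) (by rwa [height_toA, height_toA])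

lemma toA_single (X : Finset (Fin n)) (i : Fin n) :
    toA (symmDiff X {i}) = symmDiff (toA X) {(i, true), starJ (i, true)} := by
  ext ⟨c, b⟩
  simp only [mem_symmDiff, mem_toA, mem_insert, mem_singleton, starJ, Prod.mk.injEq]
  cases b <;> simp <;> tauto

lemma toA_pair (X : Finset (Fin n)) (i j : Fin n) :
    toA (symmDiff X {i, j}) =
      symmDiff (toA X) {(i, true), starJ (i, true), (j, true), starJ (j, true)} := by
  ext ⟨c, b⟩
  simp only [mem_symmDiff, mem_toA, mem_insert, mem_singleton, starJ, Prod.mk.injEq]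
  cases b <;> simp <;> tauto

lemma sq_aux (hs : IsOrientation ℬ s) {X : Finset (Fin n)} {i j : Fin n} (hij : i ≠ j)
    (hX : DD ℬ X) (hi : DD ℬ (symmDiff X {i})) (hj : DD ℬ (symmDiff X {j}))
    (h : DD ℬ (symmDiff X {i, j})) (h1 : sg s X (symmDiff X {i, j}) = 1)
    (h2 : sg s X (symmDiff X {i}) = 1) (h3 : sg s X (symmDiff X {j}) = -1) : False := by
  have h0 := sg_self hs hX
  have hd := card_pair hij
  have hq := (hs.2.1 _ hX).2.2.2.1
    ![toA X, toA (symmDiff X {i}), toA (symmDiff X {j}), toA (symmDiff X {i, j})]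
    ⟨toA X, (i, true), (j, true), hij, rfl, toA_single X i, toA_single X j, toA_pair X i j, by
      intro k; fin_cases k
      · exact hX
      · exact hi
      · exact hj
      · exact h⟩ 2
  have e0 : heightF (toA X) (toA X) = 0 := by rw [height_toA]; simp
  unfold sg at h0 h1 h2 h3
  rcases hq ⟨by
    intro l m hl hm
    fin_cases l <;> fin_cases m <;> simp_all, 0, by decide, by simp [h0, h3]⟩ with hh | hh
  · have := hh 3
    simp [height_sd, hd] at this
  · have := hh 0
    simp [height_sd, e0] at this

lemma cochain (hM : IsLagrangianMatroid ℬ) (hs : IsOrientation ℬ s) :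
    Cochain (DD ℬ) (fun X Y => - sg s X Y) where
  exch := exch_lag hM
  anti := by
    intro X i hX hi
    have := sg_change hs hi hX hX
    rw [inter_self, sg_self hs hX] at this
    have e : symmDiff (symmDiff X {i}) X = {i} := by
      rw [symmDiff_comm, symmDiff_symmDiff_cancel_left]
    rw [e] at this
    simp only [this]; simp
  sq := by
    intro X i j hij hX hi hj h
    rw [sg_mono hs hX (by simp) hi h, sg_mono hs hX (by simp) hj h]
    rcases sg_val hs hX hi with p | p <;> rcases sg_val hs hX hj with q | q <;>
      rcases sg_val hs hX h with r | r <;> rw [p, q, r] <;> try norm_num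
    · exact sq_aux hs hij hX hi hj h r p q
    · exact sq_aux hs hij.symm hX hj hi (by rwa [pair_comm]) (by rwa [pair_comm]) q p
  tri := by
    intro X i j hij hX hi hj h
    rw [sg_mono hs hX (by simp) hi h]
    have := sg_long_ne hM hs hij hX hX h (fun hh => hj hh.2) (by
      rw [symmDiff_symmDiff_cancel_left, card_pair hij]; simp)
    rw [sg_self hs hX] at this
    linear_combination (-sg s X (symmDiff X {i})) * this
  rect := by
    intro X i j k hij hik hjk hX hi hjk' h hj hk hij' hik'
    rw [sg_mono hs hX (by simp) hjk' h]
    have h1 := sg_long_ne hM hs hjk hX hX hjk' (fun hh => hj hh.1) (by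
      rw [symmDiff_symmDiff_cancel_left, card_pair hjk]; simp)
    rw [sg_self hs hX] at h1
    have e3 : symmDiff (symmDiff X {i}) {j, k} = symmDiff X {i, j, k} := by
      ext c; simp only [mem_symmDiff, mem_insert, mem_singleton]; grind
    have e2 : symmDiff (symmDiff X {i}) {j} = symmDiff X {i, j} := by
      ext c; simp only [mem_symmDiff, mem_insert, mem_singleton]; grind
    have h2 := sg_long_ne hM hs hjk hX hi (by rwa [e3]) (by rw [e2]; exact fun hh => hij' hh.1) (by
      rw [e3, symmDiff_symmDiff_cancel_left, symmDiff_symmDiff_cancel_left]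
      have : ({i, j, k} : Finset (Fin n)).card = 3 := by
        rw [card_eq_three]; exact ⟨i, j, k, hij, hik, hjk, rfl⟩
      rw [this]; simp)
    rw [e3] at h2
    linear_combination (sg s X (symmDiff X {i, j, k})) * h1 - h2

lemma good_add {δ : Finset (Fin n) → Finset (Fin n) → ℤ} {d} (hG : Good (DD ℬ) d (n + 1 + 1) δ)
    {X Y Z} (hX : DD ℬ X) (hY : DD ℬ Y) (hZ : DD ℬ Z) : δ X Y + δ Y Z = δ X Z := by
  apply hG.add X Y Z hX hY hZ
  have := card_le_univ (symmDiff X Y ∪ symmDiff X Z)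
  rw [Fintype.card_fin] at this
  omega

lemma card_sd_single (F X : Finset (Fin n)) (i : Fin n) :
    ((symmDiff F (symmDiff X {i})).card : ℤ) =
      (symmDiff F X).card + (if i ∈ symmDiff F X then -1 else 1) := by
  rw [← symmDiff_assoc]
  set S := symmDiff F X
  by_cases h : i ∈ S
  · have : symmDiff S {i} = S.erase i := by
      ext c; simp only [mem_symmDiff, mem_singleton, mem_erase]; grind
    rw [this, card_erase_of_mem h, if_pos h]
    have := card_pos.2 ⟨i, h⟩
    omega
  · have : symmDiff S {i} = insert i S := by
      ext c; simp only [mem_symmDiff, mem_singleton, mem_insert]; grind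
    rw [this, card_insert_of_notMem h, if_neg h]; simp

lemma card_sd_pair (F X : Finset (Fin n)) {i j : Fin n} (hij : i ≠ j) :
    ((symmDiff F (symmDiff X {i, j})).card : ℤ) =
      (symmDiff F X).card + (if i ∈ symmDiff F X then -1 else 1)
        + (if j ∈ symmDiff F X then -1 else 1) := by
  have e : symmDiff X {i, j} = symmDiff (symmDiff X {i}) {j} := by
    ext c; simp only [mem_symmDiff, mem_insert, mem_singleton]; grind
  rw [e, card_sd_single, card_sd_single]
  have : j ∈ symmDiff F (symmDiff X {i}) ↔ j ∈ symmDiff F X := by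
    simp only [mem_symmDiff, mem_singleton]; grind
  simp only [this]

lemma step_claim (hM : IsLagrangianMatroid ℬ) (hs : IsOrientation ℬ s)
    {δ : Finset (Fin n) → Finset (Fin n) → ℤ}
    (hG : Good (DD ℬ) (fun X Y => - sg s X Y) (n + 1 + 1) δ) {F X Y : Finset (Fin n)}
    (hF : DD ℬ F) (he : IsEdge ℬ (toA X) (toA Y))
    (hle : (symmDiff F X).card ≤ (symmDiff F Y).card) :
    2 * (if sg s F X ≠ sg s F Y then (1 : ℤ) else 0) =
      (symmDiff F Y).card - (symmDiff F X).card + δ X Y := by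
  have hX : DD ℬ X := he.1
  have hY : DD ℬ Y := he.2.1
  rcases edge_cases hM he with ⟨i, rfl⟩ | ⟨i, j, hij, rfl, hn⟩
  · rw [hG.short X i hX hY]
    have hc := card_sd_single F X i
    have hi : i ∉ symmDiff F X := by
      intro h; rw [if_pos h] at hc; omega
    rw [if_neg hi] at hc
    have h1 := sg_mono hs (S := symmDiff F X) (S' := symmDiff F (symmDiff X {i})) hF (by
      intro c
      have : c = i → i ∉ symmDiff F X := fun _ => hi
      simp only [mem_symmDiff, mem_singleton] at *; grind)
      (by rwa [symmDiff_symmDiff_cancel_left]) (by rwa [symmDiff_symmDiff_cancel_left])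
    rw [symmDiff_symmDiff_cancel_left, symmDiff_symmDiff_cancel_left] at h1
    rw [h1]
    rcases sg_val hs hF hX with p | p <;> rcases sg_val hs hF hY with q | q <;>
      rw [p, q] <;> norm_num <;> omega
  · rw [hG.long (by omega) X i j hij hX hY hn]
    have hc := card_sd_pair F X hij
    by_cases hh : (symmDiff F X).card = (symmDiff F (symmDiff X {i, j})).card
    · rw [sg_long_eq hM hs hij hF hX hY hn hh, hh]; simp
    · rw [sg_long_ne hM hs hij hF hX hY hn hh]
      have : -sg s F (symmDiff X {i, j}) ≠ sg s F (symmDiff X {i, j}) := by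
        rcases sg_val hs hF hY with q | q <;> rw [q] <;> norm_num
      rw [if_pos this]
      split_ifs at hc <;> omega

lemma path_claim (hM : IsLagrangianMatroid ℬ) (hs : IsOrientation ℬ s)
    {δ : Finset (Fin n) → Finset (Fin n) → ℤ}
    (hG : Good (DD ℬ) (fun X Y => - sg s X Y) (n + 1 + 1) δ) {F : Finset (Fin n)}
    (hF : DD ℬ F) {v : ℕ → Finset (JJ n)} {p : ℕ} (hv : IncreasingPath ℬ (toA F) v p) :
    ∀ q ≤ p, ∃ X, toA X = v q ∧ DD ℬ X ∧
      2 * (signChanges (s (toA F)) v q : ℤ) = (symmDiff F X).card + δ F X := by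
  obtain ⟨h0, hE, L, hL, hinc⟩ := hv
  intro q
  induction q with
  | zero =>
    intro _
    refine ⟨F, h0.symm, hF, ?_⟩
    rw [hG.self hF]; simp [signChanges]
  | succ q ih =>
    intro hq
    obtain ⟨X, hX, hXD, hsum⟩ := ih (by omega)
    have he := hE q hq
    obtain ⟨Y, hYD, hY⟩ := lag_from hM he.2.1
    refine ⟨Y, hY, hYD, ?_⟩
    rw [← hX, ← hY] at he
    have hle : (symmDiff F X).card ≤ (symmDiff F Y).card := by
      by_contra hlt
      push Not at hlt
      have h1 := hL (toA X) hXD (toA Y) hYD (by rwa [height_toA, height_toA])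
      have h2 := hinc q hq
      rw [← hX, ← hY] at h2
      exact lt_asymm h1 h2
    have hst := step_claim hM hs hG hF he hle
    have e : (signChanges (s (toA F)) v (q + 1) : ℤ) = signChanges (s (toA F)) v q +
        (if sg s F X ≠ sg s F Y then (1 : ℤ) else 0) := by
      unfold signChanges sg
      rw [hX, hY, range_add_one, filter_insert]
      split_ifs with h
      · rw [card_insert_of_notMem (by simp)]; simp
      · simp
    rw [e]
    have := good_add hG hF hXD hYD
    linarith

lemma sd_closer {X Y P : Finset (Fin n)} (h : P ⊆ symmDiff X Y) :
    symmDiff (symmDiff X P) Y = symmDiff X Y \ P := by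
  ext c
  have := @h c
  simp only [mem_symmDiff, mem_sdiff] at *; tauto

lemma max_claim (hM : IsLagrangianMatroid ℬ)
    {δ d : Finset (Fin n) → Finset (Fin n) → ℤ}
    (hG : Good (DD ℬ) d (n + 1 + 1) δ) {F Y : Finset (Fin n)} (hY : DD ℬ Y)
    (hYm : ∀ Z, DD ℬ Z → (symmDiff F Z).card ≤ (symmDiff F Y).card) :
    ∀ (m : ℕ) (X : Finset (Fin n)), (symmDiff X Y).card = m → DD ℬ X →
      (symmDiff F X).card = (symmDiff F Y).card → δ X Y = 0 := by
  intro m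
  induction m using Nat.strong_induction_on with
  | _ m ih =>
    intro X hm hX hc
    by_cases hXY : X = Y
    · subst hXY; exact hG.self hX
    have hsub : ¬ symmDiff F Y ⊆ symmDiff F X := by
      intro h
      have := eq_of_subset_of_card_le h hc.le
      exact hXY (symmDiff_right_injective F this.symm)
    obtain ⟨i, hiY, hiX⟩ := not_subset.1 hsub
    have hi : i ∈ symmDiff X Y := by simp only [mem_symmDiff] at *; tauto
    have hni : ¬ DD ℬ (symmDiff X {i}) := by
      intro h
      have h1 := hYm _ h
      have h2 := card_sd_single F X i
      rw [if_neg hiX] at h2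
      omega
    obtain ⟨j, hj, hD⟩ := exch_lag hM X Y hX hY i hi
    have hij : i ≠ j := by
      rintro rfl
      rw [pair_eq_singleton] at hD
      exact hni hD
    have h2 := card_sd_pair F X hij
    rw [if_neg hiX] at h2
    have h1 := hYm _ hD
    have hjX : j ∈ symmDiff F X := by
      by_contra hjX
      rw [if_neg hjX] at h2
      omega
    rw [if_pos hjX] at h2
    have hl := hG.long (by omega) X i j hij hX hD (fun h => hni h.1)
    have hlt : (symmDiff (symmDiff X {i, j}) Y).card < m := by
      rw [← hm]
      apply card_lt_card
      have hP : ({i, j} : Finset (Fin n)) ⊆ symmDiff X Y := by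
        intro c hc; simp only [mem_insert, mem_singleton] at hc
        rcases hc with rfl | rfl <;> assumption
      rw [sd_closer hP]
      exact sdiff_ssubset hP (by simp)
    have h3 := ih _ hlt (symmDiff X {i, j}) rfl hD (by omega)
    have := good_add hG hX hD hY
    linarith
end fin

/-- For an oriented Lagrangian matroid `(ℬ, s)` and a fundamental
basis `F`, the number of changes of sign of `A ↦ s F A` along an increasing path from
`F` to a basis of maximal height relative to `F` is the same for all such paths (over
all compatible linear functionals and all terminal bases of maximal height): the index
relative to `F` is well defined. -/
theorem index_well_defined {n : ℕ}
    (ℬ : Finset (Finset (JJ n))) (hM : IsLagrangianMatroid ℬ)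
    (s : Finset (JJ n) → Finset (JJ n) → ℤ) (hs : IsOrientation ℬ s)
    (F : Finset (JJ n)) (hF : F ∈ ℬ)
    (v w : ℕ → Finset (JJ n)) (p q : ℕ)
    (hv : IncreasingPath ℬ F v p) (hvmax : MaxHeightBasis ℬ F (v p))
    (hw : IncreasingPath ℬ F w q) (hwmax : MaxHeightBasis ℬ F (w q)) :
    signChanges (s F) v p = signChanges (s F) w q := by
  obtain ⟨F, hFD, rfl⟩ := lag_from hM hF
  obtain ⟨δ, hG⟩ := potential (cochain hM hs) (n + 1)
  obtain ⟨X, hX, hXD, h1⟩ := path_claim hM hs hG hFD hv p le_rfl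
  obtain ⟨Y, hY, hYD, h2⟩ := path_claim hM hs hG hFD hw q le_rfl
  rw [← hX] at hvmax
  rw [← hY] at hwmax
  have m1 : ∀ Z, DD ℬ Z → (symmDiff F Z).card ≤ (symmDiff F X).card := by
    intro Z hZ
    have := hvmax.2 _ hZ
    rwa [height_toA, height_toA] at this
  have m2 : ∀ Z, DD ℬ Z → (symmDiff F Z).card ≤ (symmDiff F Y).card := by
    intro Z hZ
    have := hwmax.2 _ hZ
    rwa [height_toA, height_toA] at this
  have hc : (symmDiff F X).card = (symmDiff F Y).card := le_antisymm (m2 X hXD) (m1 Y hYD)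
  have h3 := max_claim hM hG hYD m2 _ X rfl hXD hc
  have h4 := good_add hG hFD hXD hYD
  rw [hc] at h1
  omega
end
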